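/- arXiv:math-ph/0601057 — 4 statements merged into one kernel-verified Lean document; each statement's English description precedes it below -/
import Mathlib

section
/- For every γ ∈ (−∞, 0), one has −γ² ≤ Θ(γ) ≤ −γ² + 1/(4γ²). -/
open MeasureTheory Set Filter

/-- An admissible function on the half-line `[0,∞)`: `u` is continuous on `[0,∞)`,
locally absolutely continuous with derivative `u'` (expressed by the integral
representation), and `u`, `u'`, `t·u(t)` all belong to `L²((0,∞))`. -/
structure AdmissibleHL (u u' : ℝ → ℂ) : Prop where
  cont : ContinuousOn u (Ici 0)
  locInt : ∀ t ∈ Ici (0:ℝ), IntervalIntegrable u' volume 0 t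
  ac : ∀ t ∈ Ici (0:ℝ), u t = u 0 + ∫ s in (0:ℝ)..t, u' s
  memL2 : IntegrableOn (fun t => ‖u t‖ ^ 2) (Ioi 0)
  memL2' : IntegrableOn (fun t => ‖u' t‖ ^ 2) (Ioi 0)
  memL2t : IntegrableOn (fun t => t ^ 2 * ‖u t‖ ^ 2) (Ioi 0)

/-- The quadratic form `q[γ,ξ](u) = ∫₀^∞ (|u'|² + (t-ξ)²|u|²) dt + γ|u(0)|²`. -/
noncomputable def qform (γ ξ : ℝ) (u u' : ℝ → ℂ) : ℝ :=
  (∫ t in Ioi (0:ℝ), (‖u' t‖ ^ 2 + (t - ξ) ^ 2 * ‖u t‖ ^ 2)) + γ * ‖u 0‖ ^ 2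

/-- The ground state energy `μ⁽¹⁾(γ,ξ)`: the infimum of the Rayleigh quotients of
the quadratic form `q[γ,ξ]` over admissible functions not identically zero. -/
noncomputable def mu1 (γ ξ : ℝ) : ℝ :=
  sInf { r : ℝ | ∃ u u' : ℝ → ℂ, AdmissibleHL u u' ∧ (∃ t ∈ Ici (0:ℝ), u t ≠ 0) ∧
    r = qform γ ξ u u' / ∫ t in Ioi (0:ℝ), ‖u t‖ ^ 2 }

/-- `Θ(γ) = inf_{ξ ∈ ℝ} μ⁽¹⁾(γ,ξ)`. -/
noncomputable def Theta (γ : ℝ) : ℝ := ⨅ ξ : ℝ, mu1 γ ξ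

/-- A ground state of `H[γ,ξ]` with eigenvalue `μ`: a twice continuously differentiable
positive function on `[0,∞)`, `L²`-normalized, with `φ, φ', t²·φ(t) ∈ L²((0,∞))`,
satisfying `-φ'' + (t-ξ)²φ = μ·φ` on `[0,∞)` and the boundary condition `φ'(0) = γ·φ(0)`. -/
structure IsGroundState (γ ξ μ : ℝ) (φ φ' φ'' : ℝ → ℝ) : Prop where
  deriv1 : ∀ t ∈ Ici (0:ℝ), HasDerivWithinAt φ (φ' t) (Ici 0) t
  deriv2 : ∀ t ∈ Ici (0:ℝ), HasDerivWithinAt φ' (φ'' t) (Ici 0) t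
  cont2 : ContinuousOn φ'' (Ici 0)
  pos : ∀ t ∈ Ici (0:ℝ), 0 < φ t
  normalized : (∫ t in Ioi (0:ℝ), (φ t) ^ 2) = 1
  memL2 : IntegrableOn (fun t => (φ t) ^ 2) (Ioi 0)
  memL2' : IntegrableOn (fun t => (φ' t) ^ 2) (Ioi 0)
  memL2t : IntegrableOn (fun t => (t ^ 2 * φ t) ^ 2) (Ioi 0)
  eqn : ∀ t ∈ Ici (0:ℝ), -φ'' t + (t - ξ) ^ 2 * φ t = μ * φ t
  bc : φ' 0 = γ * φ 0

/-- The fundamental theorem of calculus for the square of an absolutely continuous function. -/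
lemma sq_sub_sq_eq_integral {f f' : ℝ → ℝ} {c T : ℝ} (hT : 0 ≤ T)
    (hint : IntervalIntegrable f' volume 0 T)
    (hf : ∀ t ∈ Icc 0 T, f t = c + ∫ s in (0:ℝ)..t, f' s) :
    IntervalIntegrable (fun t => 2 * (f t * f' t)) volume 0 T ∧
      f T ^ 2 - f 0 ^ 2 = ∫ t in (0:ℝ)..T, 2 * (f t * f' t) := by
  set F : ℝ → ℝ := fun t => c + ∫ s in (0:ℝ)..t, f' s with hF
  have hacF : AbsolutelyContinuousOnInterval F 0 T :=
    (LipschitzWith.const c).lipschitzOnWith.absolutelyContinuousOnInterval.fun_add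
      (hint.absolutelyContinuousOnInterval_intervalIntegral left_mem_uIcc)
  have hcont : ContinuousOn f (uIcc 0 T) :=
    hacF.continuousOn.congr fun t ht => hf t (by rwa [uIcc_of_le hT] at ht)
  refine ⟨(hint.continuousOn_mul hcont).const_mul 2, ?_⟩
  have hparts := hacF.integral_deriv_mul_eq_sub hacF
  rw [hf T ⟨hT, le_rfl⟩, hf 0 ⟨le_rfl, hT⟩, sq, sq]
  refine hparts.symm.trans (intervalIntegral.integral_congr_ae ?_)
  filter_upwards [hint.ae_hasDerivAt_integral] with x hx hxT
  have hx' : x ∈ uIcc 0 T := uIoc_subset_uIcc hxT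
  have hd : deriv F x = f' x := ((hx hx' 0 left_mem_uIcc).const_add c).deriv
  rw [hd, hf x (by rwa [uIcc_of_le hT] at hx')]
  ring

/-- A nonnegative integrable function on the half-line takes arbitrarily small values. -/
lemma exists_lt_of_integrableOn_Ioi {g : ℝ → ℝ} (hg : IntegrableOn g (Ioi 0)) {ε : ℝ}
    (hε : 0 < ε) : ∃ T, 0 < T ∧ g T < ε := by
  by_contra! h
  have hconst : IntegrableOn (fun _ : ℝ => ε) (Ioi 0) :=
    Integrable.mono' hg aestronglyMeasurable_const <| by
      filter_upwards [ae_restrict_mem measurableSet_Ioi] with t ht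
      rw [Real.norm_of_nonneg hε.le]
      exact h t ht
  simp [integrableOn_const_iff, hε.ne'] at hconst

/-- The Robin boundary term is controlled by the Dirichlet energy and the mass. -/
lemma AdmissibleHL.mul_norm_sq_zero_le {u u' : ℝ → ℂ} (h : AdmissibleHL u u') {a : ℝ}
    (ha : 0 < a) :
    a * ‖u 0‖ ^ 2 ≤ ∫ t in Ioi (0:ℝ), (‖u' t‖ ^ 2 + a ^ 2 * ‖u t‖ ^ 2) := by
  have hI : IntegrableOn (fun t => ‖u' t‖ ^ 2 + a ^ 2 * ‖u t‖ ^ 2) (Ioi 0) :=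
    h.memL2'.add (h.memL2.const_mul _)
  refine le_of_forall_pos_lt_add fun ε hε => ?_
  obtain ⟨T, hT, hTε⟩ := exists_lt_of_integrableOn_Ioi h.memL2 (div_pos hε ha)
  have hint := h.locInt T hT.le
  have hre : ∀ t ∈ Icc 0 T, (u t).re = (u 0).re + ∫ s in (0:ℝ)..t, (u' s).re := fun t ht => by
    have := congrArg Complex.reCLM (h.ac t ht.1)
    rwa [map_add, ← Complex.reCLM.intervalIntegral_comp_comm (h.locInt t ht.1)] at this
  have him : ∀ t ∈ Icc 0 T, (u t).im = (u 0).im + ∫ s in (0:ℝ)..t, (u' s).im := fun t ht => by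
    have := congrArg Complex.imCLM (h.ac t ht.1)
    rwa [map_add, ← Complex.imCLM.intervalIntegral_comp_comm (h.locInt t ht.1)] at this
  have hre_int : IntervalIntegrable (fun t => (u' t).re) volume 0 T := ⟨hint.1.re, hint.2.re⟩
  have him_int : IntervalIntegrable (fun t => (u' t).im) volume 0 T := ⟨hint.1.im, hint.2.im⟩
  obtain ⟨ir, er⟩ := sq_sub_sq_eq_integral hT.le hre_int hre
  obtain ⟨ii, ei⟩ := sq_sub_sq_eq_integral hT.le him_int him
  have hI' : IntervalIntegrable (fun t => ‖u' t‖ ^ 2 + a ^ 2 * ‖u t‖ ^ 2) volume 0 T :=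
    (intervalIntegrable_iff_integrableOn_Ioc_of_le hT.le).2 (hI.mono_set Ioc_subset_Ioi_self)
  have hnorm : ∀ z : ℂ, ‖z‖ ^ 2 = z.re ^ 2 + z.im ^ 2 := fun z => by
    rw [Complex.sq_norm, Complex.normSq_apply]; ring
  have hle : ∫ t in (0:ℝ)..T, -a * (2 * ((u t).re * (u' t).re) + 2 * ((u t).im * (u' t).im)) ≤
      ∫ t in (0:ℝ)..T, (‖u' t‖ ^ 2 + a ^ 2 * ‖u t‖ ^ 2) := by
    refine intervalIntegral.integral_mono_on hT.le ((ir.add ii).const_mul (-a)) hI' fun t _ => ?_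
    rw [hnorm, hnorm]
    nlinarith [sq_nonneg ((u' t).re + a * (u t).re), sq_nonneg ((u' t).im + a * (u t).im)]
  rw [intervalIntegral.integral_const_mul, intervalIntegral.integral_add ir ii, ← er, ← ei] at hle
  have hext : ∫ t in (0:ℝ)..T, (‖u' t‖ ^ 2 + a ^ 2 * ‖u t‖ ^ 2) ≤
      ∫ t in Ioi (0:ℝ), (‖u' t‖ ^ 2 + a ^ 2 * ‖u t‖ ^ 2) := by
    rw [intervalIntegral.integral_of_le hT.le]
    exact setIntegral_mono_set hI (ae_of_all _ fun t => by positivity)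
      (ae_of_all _ Ioc_subset_Ioi_self)
  rw [lt_div_iff₀ ha, hnorm] at hTε
  rw [hnorm]
  linarith

lemma AdmissibleHL.neg_sq_mul_le_qform {u u' : ℝ → ℂ} (h : AdmissibleHL u u') {γ : ℝ}
    (hγ : γ < 0) (ξ : ℝ) :
    -γ ^ 2 * ∫ t in Ioi (0:ℝ), ‖u t‖ ^ 2 ≤ qform γ ξ u u' := by
  have hbdry := h.mul_norm_sq_zero_le (neg_pos.2 hγ)
  rw [neg_sq, integral_add h.memL2' (h.memL2.const_mul _), integral_const_mul] at hbdry
  have hmono : ∫ t in Ioi (0:ℝ), ‖u' t‖ ^ 2 ≤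
      ∫ t in Ioi (0:ℝ), (‖u' t‖ ^ 2 + (t - ξ) ^ 2 * ‖u t‖ ^ 2) := by
    refine integral_mono h.memL2' (h.memL2'.add ?_) fun t => ?_
    · have hweight : IntegrableOn (fun t => 2 * (t ^ 2 * ‖u t‖ ^ 2) + 2 * ξ ^ 2 * ‖u t‖ ^ 2)
          (Ioi 0) := (h.memL2t.const_mul 2).add (h.memL2.const_mul (2 * ξ ^ 2))
      have hmeas : AEStronglyMeasurable (fun t => (t - ξ) ^ 2 * ‖u t‖ ^ 2)
          (volume.restrict (Ioi 0)) :=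
        (by fun_prop : Continuous fun t : ℝ => (t - ξ) ^ 2).aestronglyMeasurable.mul h.memL2.1
      refine Integrable.mono' hweight hmeas (ae_of_all _ fun t => ?_)
      rw [Real.norm_of_nonneg (by positivity)]
      nlinarith [mul_nonneg (sq_nonneg (t + ξ)) (sq_nonneg ‖u t‖)]
    · exact le_add_of_nonneg_right (by positivity)
  unfold qform
  linarith

lemma AdmissibleHL.neg_sq_le_rayleigh {u u' : ℝ → ℂ} (h : AdmissibleHL u u') {γ : ℝ}
    (hγ : γ < 0) (ξ : ℝ) :
    -γ ^ 2 ≤ qform γ ξ u u' / ∫ t in Ioi (0:ℝ), ‖u t‖ ^ 2 := by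
  have hN : 0 ≤ ∫ t in Ioi (0:ℝ), ‖u t‖ ^ 2 := integral_nonneg fun t => by positivity
  rcases hN.eq_or_lt with hN | hN
  · rw [← hN, div_zero]
    nlinarith [sq_nonneg γ]
  · exact (le_div_iff₀ hN).2 (h.neg_sq_mul_le_qform hγ ξ)

lemma integrableOn_pow_mul_exp_neg_mul {b : ℝ} (hb : 0 < b) (n : ℕ) :
    IntegrableOn (fun t : ℝ => t ^ n * Real.exp (-b * t)) (Ioi 0) := by
  simpa using integrableOn_rpow_mul_exp_neg_mul_rpow (p := 1) (s := n) (b := b)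
    (by linarith [n.cast_nonneg (α := ℝ)]) one_pos hb

lemma integral_pow_mul_exp_neg_mul {b : ℝ} (hb : 0 < b) (n : ℕ) :
    ∫ t in Ioi (0:ℝ), t ^ n * Real.exp (-b * t) = n.factorial / b ^ (n + 1) := by
  have h := integral_rpow_mul_exp_neg_mul_rpow (p := 1) (q := n) (b := b) one_pos
    (by linarith [n.cast_nonneg (α := ℝ)]) hb
  simp only [Real.rpow_natCast, Real.rpow_one, div_one, Real.Gamma_nat_eq_factorial] at h
  rw [h, Real.rpow_neg hb.le, ← Nat.cast_add_one, Real.rpow_natCast]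
  ring

lemma norm_ofReal_exp_mul_sq (γ t : ℝ) :
    ‖((Real.exp (γ * t) : ℝ) : ℂ)‖ ^ 2 = t ^ 0 * Real.exp (-(-2 * γ) * t) := by
  rw [Complex.norm_of_nonneg (Real.exp_pos _).le, sq, ← Real.exp_add, pow_zero, one_mul]
  ring_nf

lemma norm_ofReal_deriv_exp_mul_sq (γ t : ℝ) :
    ‖((γ * Real.exp (γ * t) : ℝ) : ℂ)‖ ^ 2 = γ ^ 2 * (t ^ 0 * Real.exp (-(-2 * γ) * t)) := by
  rw [Complex.ofReal_mul, norm_mul, mul_pow, norm_ofReal_exp_mul_sq, Complex.norm_real,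
    Real.norm_eq_abs, sq_abs]

lemma admissibleHL_exp {γ : ℝ} (hγ : γ < 0) :
    AdmissibleHL (fun t => (Real.exp (γ * t) : ℝ)) (fun t => (γ * Real.exp (γ * t) : ℝ)) where
  cont := by fun_prop
  locInt t _ := (by fun_prop : Continuous _).intervalIntegrable _ _
  ac t _ := by
    have hd : ∀ x ∈ uIcc 0 t, HasDerivAt (fun s => Real.exp (γ * s)) (γ * Real.exp (γ * x)) x :=
      fun x _ => by simpa [mul_comm] using ((hasDerivAt_id x).const_mul γ).exp
    rw [intervalIntegral.integral_ofReal, intervalIntegral.integral_eq_sub_of_hasDerivAt hd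
      ((by fun_prop : Continuous _).intervalIntegrable _ _)]
    push_cast
    ring
  memL2 := by
    simp only [norm_ofReal_exp_mul_sq]
    exact integrableOn_pow_mul_exp_neg_mul (by linarith) 0
  memL2' := by
    simp only [norm_ofReal_deriv_exp_mul_sq]
    exact (integrableOn_pow_mul_exp_neg_mul (by linarith) 0).const_mul _
  memL2t := by
    simp only [norm_ofReal_exp_mul_sq, pow_zero, one_mul]
    exact integrableOn_pow_mul_exp_neg_mul (by linarith) 2

lemma integral_norm_exp_sq {γ : ℝ} (hγ : γ < 0) :
    ∫ t in Ioi (0:ℝ), ‖((Real.exp (γ * t) : ℝ) : ℂ)‖ ^ 2 = 1 / (-2 * γ) := by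
  simp only [norm_ofReal_exp_mul_sq]
  rw [integral_pow_mul_exp_neg_mul (by linarith) 0]
  simp

lemma rayleigh_exp {γ : ℝ} (hγ : γ < 0) :
    qform γ (1 / (-2 * γ)) (fun t => (Real.exp (γ * t) : ℝ))
        (fun t => (γ * Real.exp (γ * t) : ℝ)) /
      ∫ t in Ioi (0:ℝ), ‖((Real.exp (γ * t) : ℝ) : ℂ)‖ ^ 2 = -γ ^ 2 + 1 / (4 * γ ^ 2) := by
  have hb : 0 < -2 * γ := by linarith
  have hI := integrableOn_pow_mul_exp_neg_mul hb
  rw [integral_norm_exp_sq hγ, qform]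
  set ξ := 1 / (-2 * γ) with hξ
  have hexpand : ∀ t : ℝ, ‖((γ * Real.exp (γ * t) : ℝ) : ℂ)‖ ^ 2 +
      (t - ξ) ^ 2 * ‖((Real.exp (γ * t) : ℝ) : ℂ)‖ ^ 2 =
      (γ ^ 2 + ξ ^ 2) * (t ^ 0 * Real.exp (-(-2 * γ) * t)) +
        -2 * ξ * (t ^ 1 * Real.exp (-(-2 * γ) * t)) + t ^ 2 * Real.exp (-(-2 * γ) * t) :=
    fun t => by
      rw [norm_ofReal_exp_mul_sq, norm_ofReal_deriv_exp_mul_sq]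
      ring
  simp only [hexpand]
  rw [integral_add (by exact ((hI 0).const_mul _).add ((hI 1).const_mul _)) (hI 2),
    integral_add ((hI 0).const_mul _) ((hI 1).const_mul _), integral_const_mul,
    integral_const_mul, integral_pow_mul_exp_neg_mul hb, integral_pow_mul_exp_neg_mul hb,
    integral_pow_mul_exp_neg_mul hb, norm_ofReal_exp_mul_sq, hξ]
  have hγ0 : γ ≠ 0 := hγ.ne
  simp [Nat.factorial]
  field_simp
  ring

/-- For every `γ < 0`, `−γ² ≤ Θ(γ) ≤ −γ² + 1/(4γ²)`. -/
theorem Theta_neg_asymptotics (γ : ℝ) (hγ : γ < 0) :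
    -γ ^ 2 ≤ Theta γ ∧ Theta γ ≤ -γ ^ 2 + 1 / (4 * γ ^ 2) := by
  have hexp_ne : ∃ t ∈ Ici (0:ℝ), ((Real.exp (γ * t) : ℝ) : ℂ) ≠ 0 :=
    ⟨0, self_mem_Ici, by simp⟩
  have hbound : ∀ ξ, -γ ^ 2 ∈ lowerBounds { r : ℝ | ∃ u u' : ℝ → ℂ, AdmissibleHL u u' ∧
      (∃ t ∈ Ici (0:ℝ), u t ≠ 0) ∧
      r = qform γ ξ u u' / ∫ t in Ioi (0:ℝ), ‖u t‖ ^ 2 } := by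
    rintro ξ r ⟨u, u', hu, -, rfl⟩
    exact hu.neg_sq_le_rayleigh hγ ξ
  have hmu : ∀ ξ, -γ ^ 2 ≤ mu1 γ ξ := fun ξ =>
    le_csInf ⟨_, _, _, admissibleHL_exp hγ, hexp_ne, rfl⟩ (hbound ξ)
  refine ⟨le_ciInf hmu, ?_⟩
  calc Theta γ ≤ mu1 γ (1 / (-2 * γ)) := ciInf_le ⟨-γ ^ 2, forall_mem_range.2 hmu⟩ _
    _ ≤ -γ ^ 2 + 1 / (4 * γ ^ 2) :=
      csInf_le ⟨_, hbound _⟩ ⟨_, _, admissibleHL_exp hγ, hexp_ne, (rayleigh_exp hγ).symm⟩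
end

section
/- There exist constants C₀ > 0 and γ₀ > 0 such that for all γ ∈ [γ₀, +∞), one has 1 − C₀·γ·exp(−γ²) ≤ Θ(γ) < 1. -/
open MeasureTheory Set Filter

/-- Product rule for primitives of integrable functions. -/
theorem integral_mul_primitive {f f' g g' : ℝ → ℝ} {T : ℝ} (hT : 0 ≤ T)
    (hf' : IntervalIntegrable f' volume 0 T) (hg' : IntervalIntegrable g' volume 0 T)
    (hf : ∀ t ∈ Icc 0 T, f t = f 0 + ∫ s in (0:ℝ)..t, f' s)
    (hg : ∀ t ∈ Icc 0 T, g t = g 0 + ∫ s in (0:ℝ)..t, g' s) :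
    ∫ t in (0:ℝ)..T, (f' t * g t + f t * g' t) = f T * g T - f 0 * g 0 := by
  have hac : ∀ (c : ℝ) (k : ℝ → ℝ), IntervalIntegrable k volume 0 T →
      AbsolutelyContinuousOnInterval (fun t => c + ∫ s in (0:ℝ)..t, k s) 0 T := fun c k hk =>
    ((LipschitzWith.const c).lipschitzOnWith.absolutelyContinuousOnInterval).fun_add
      (hk.absolutelyContinuousOnInterval_intervalIntegral (by simp))
  have h := (hac (f 0) f' hf').integral_deriv_mul_eq_sub (hac (g 0) g' hg')
  rw [hf T ⟨hT, le_rfl⟩, hg T ⟨hT, le_rfl⟩]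
  simp only [intervalIntegral.integral_same, add_zero] at h
  rw [← h]
  apply intervalIntegral.integral_congr_ae
  filter_upwards [hf'.ae_hasDerivAt_integral, hg'.ae_hasDerivAt_integral] with x h1 h2 hx
  have hxT : x ∈ uIcc 0 T := uIoc_subset_uIcc hx
  rw [((h1 hxT 0 (by simp)).const_add _).deriv, ((h2 hxT 0 (by simp)).const_add _).deriv]
  rw [uIcc_of_le hT] at hxT
  rw [hf x hxT, hg x hxT]

/-- Real-valued functions on `[0,∞)` with locally integrable weak derivative `f'` such that
`f`, `f'` and `t·f(t)` are square integrable. -/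
structure RealAdmissible (f f' : ℝ → ℝ) : Prop where
  locInt : ∀ t ∈ Ici (0:ℝ), IntervalIntegrable f' volume 0 t
  ac : ∀ t ∈ Ici (0:ℝ), f t = f 0 + ∫ s in (0:ℝ)..t, f' s
  memL2 : IntegrableOn (fun t => f t ^ 2) (Ioi 0)
  memL2' : IntegrableOn (fun t => f' t ^ 2) (Ioi 0)
  memL2t : IntegrableOn (fun t => t ^ 2 * f t ^ 2) (Ioi 0)

theorem aestronglyMeasurable_Ioi_of_locInt {E : Type*} [NormedAddCommGroup E] {g : ℝ → E}
    (hg : ∀ t ∈ Ici (0:ℝ), IntervalIntegrable g volume 0 t) :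
    AEStronglyMeasurable g (volume.restrict (Ioi 0)) := by
  have h : Ioi (0:ℝ) = ⋃ n : ℕ, Ioc (0:ℝ) n := by
    ext x
    simp only [mem_Ioi, mem_iUnion, mem_Ioc]
    exact ⟨fun hx => (exists_nat_ge x).imp fun n hn => ⟨hx, hn⟩, fun ⟨n, hn⟩ => hn.1⟩
  rw [h, aestronglyMeasurable_iUnion_iff]
  intro n
  have := hg n (by simp)
  rw [intervalIntegrable_iff_integrableOn_Ioc_of_le (by simp)] at this
  exact this.aestronglyMeasurable

namespace RealAdmissible

variable {f f' : ℝ → ℝ} (ξ : ℝ)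

theorem continuousOn (h : RealAdmissible f f') : ContinuousOn f (Ici 0) := by
  intro t ht
  have ht0 : (0:ℝ) ≤ t := ht
  have hI := h.locInt (t + 1) (by simp only [mem_Ici]; linarith)
  have hc : ContinuousOn (fun x => f 0 + ∫ s in (0:ℝ)..x, f' s) (Icc 0 (t + 1)) := by
    apply continuousOn_const.add
    have := intervalIntegral.continuousOn_primitive_interval
      (by rwa [uIcc_of_le (by linarith), integrableOn_Icc_iff_integrableOn_Ioc,
        ← intervalIntegrable_iff_integrableOn_Ioc_of_le (by linarith)] :
        IntegrableOn f' (uIcc 0 (t + 1)) volume)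
    rwa [uIcc_of_le (by linarith)] at this
  have h2 : ContinuousOn f (Icc 0 (t + 1)) := hc.congr fun x hx => h.ac x hx.1
  refine (h2 t ⟨ht0, by linarith⟩).mono_of_mem_nhdsWithin ?_
  rw [← Ici_inter_Iic]
  exact inter_mem_nhdsWithin _ (Iic_mem_nhds (by linarith))

theorem aestronglyMeasurable_deriv (h : RealAdmissible f f') :
    AEStronglyMeasurable f' (volume.restrict (Ioi 0)) :=
  aestronglyMeasurable_Ioi_of_locInt h.locInt

theorem aestronglyMeasurable (h : RealAdmissible f f') :
    AEStronglyMeasurable f (volume.restrict (Ioi 0)) :=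
  (h.continuousOn.mono Ioi_subset_Ici_self).aestronglyMeasurable measurableSet_Ioi

theorem integrableOn_shift_sq (h : RealAdmissible f f') :
    IntegrableOn (fun t => (t - ξ) ^ 2 * f t ^ 2) (Ioi 0) := by
  refine ((h.memL2t.const_mul 2).add (h.memL2.const_mul (2 * ξ ^ 2))).mono' ?_ ?_
  · exact (by fun_prop : Continuous fun t : ℝ => (t - ξ) ^ 2).aestronglyMeasurable.mul
      (h.aestronglyMeasurable.pow 2)
  · refine Eventually.of_forall fun t => ?_
    rw [Real.norm_of_nonneg (by positivity)]
    simp only [Pi.add_apply]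
    nlinarith [mul_nonneg (sq_nonneg (t + ξ)) (sq_nonneg (f t))]

theorem integrableOn_mul_deriv (h : RealAdmissible f f') :
    IntegrableOn (fun t => 2 * ((t - ξ) * (f t * f' t))) (Ioi 0) := by
  refine ((h.integrableOn_shift_sq ξ).add h.memL2').mono' ?_ ?_
  · exact ((by fun_prop : Continuous fun t : ℝ => (t - ξ)).aestronglyMeasurable.mul
      (h.aestronglyMeasurable.mul h.aestronglyMeasurable_deriv)).const_mul 2
  · refine Eventually.of_forall fun t => ?_
    rw [Real.norm_eq_abs, abs_le]
    simp only [Pi.add_apply]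
    constructor
    · nlinarith [sq_nonneg ((t - ξ) * f t + f' t)]
    · nlinarith [sq_nonneg ((t - ξ) * f t - f' t)]

theorem integrableOn_annihilation_sq (h : RealAdmissible f f') :
    IntegrableOn (fun t => (f' t + (t - ξ) * f t) ^ 2) (Ioi 0) := by
  refine ((h.memL2'.add (h.integrableOn_shift_sq ξ)).add (h.integrableOn_mul_deriv ξ)).congr
    (Eventually.of_forall fun t => ?_)
  simp only [Pi.add_apply]
  ring

theorem integrableOn_shift (h : RealAdmissible f f') :
    IntegrableOn (fun t => (t - ξ) * f t ^ 2) (Ioi 0) := by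
  refine ((h.integrableOn_shift_sq ξ).add h.memL2).mono' ?_ ?_
  · exact (by fun_prop : Continuous fun t : ℝ => (t - ξ)).aestronglyMeasurable.mul
      (h.aestronglyMeasurable.pow 2)
  · refine Eventually.of_forall fun t => ?_
    rw [Real.norm_eq_abs, abs_le]
    simp only [Pi.add_apply]
    have := sq_nonneg (f t)
    constructor
    · nlinarith [mul_nonneg (sq_nonneg (t - ξ + 1)) this, mul_nonneg (sq_nonneg (t - ξ)) this]
    · nlinarith [mul_nonneg (sq_nonneg (t - ξ - 1)) this, mul_nonneg (sq_nonneg (t - ξ)) this]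

theorem intervalIntegral_boundary (h : RealAdmissible f f') {T : ℝ} (hT : 0 ≤ T) :
    ∫ t in (0:ℝ)..T, (f t ^ 2 + 2 * ((t - ξ) * (f t * f' t)))
      = (T - ξ) * f T ^ 2 + ξ * f 0 ^ 2 := by
  have hsub : ∀ t : ℝ, 0 ≤ t → uIcc 0 t ⊆ Ici 0 := fun t ht => by
    rw [uIcc_of_le ht]; exact Icc_subset_Ici_self
  have hi : ∀ t, 0 ≤ t → IntervalIntegrable (fun t => f' t * f t + f t * f' t) volume 0 t :=
    fun t ht => ((h.locInt t ht).mul_continuousOn (h.continuousOn.mono (hsub t ht))).add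
      ((h.locInt t ht).continuousOn_mul (h.continuousOn.mono (hsub t ht)))
  have h2 : ∀ t ∈ Icc 0 T, f t * f t = f 0 * f 0 + ∫ s in (0:ℝ)..t, (f' s * f s + f s * f' s) := by
    intro t ht
    rw [integral_mul_primitive ht.1 (h.locInt t ht.1) (h.locInt t ht.1)
      (fun s hs => h.ac s hs.1) (fun s hs => h.ac s hs.1)]
    ring
  have h3 := integral_mul_primitive (f := fun t => t - ξ) (f' := fun _ => 1)
    (g := fun t => f t * f t) hT (by simp) (hi T hT) (by intro t _; simp; ring) h2
  calc _ = ∫ t in (0:ℝ)..T, (1 * (f t * f t) + (t - ξ) * (f' t * f t + f t * f' t)) := by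
        congr 1 with t
        ring
    _ = _ := h3
    _ = _ := by ring

theorem integral_boundary (h : RealAdmissible f f') :
    ∫ t in Ioi (0:ℝ), (f t ^ 2 + 2 * ((t - ξ) * (f t * f' t))) = ξ * f 0 ^ 2 := by
  have hint := h.memL2.add (h.integrableOn_mul_deriv ξ)
  have hlim := intervalIntegral_tendsto_integral_Ioi 0 hint tendsto_id
  have hlim' : Tendsto (fun T => (T - ξ) * f T ^ 2) atTop
      (nhds ((∫ t in Ioi (0:ℝ), (f t ^ 2 + 2 * ((t - ξ) * (f t * f' t)))) - ξ * f 0 ^ 2)) := by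
    refine (hlim.sub_const (ξ * f 0 ^ 2)).congr' ?_
    filter_upwards [eventually_ge_atTop 0] with T hT
    have := h.intervalIntegral_boundary ξ hT
    simp only [id, Pi.add_apply]
    rw [this]
    ring
  have h0 := IntegrableAtFilter.eq_zero_of_tendsto (μ := volume)
    ⟨Ioi 0, Ioi_mem_atTop 0, h.integrableOn_shift ξ⟩ (fun s hs => by
      obtain ⟨a, ha⟩ := mem_atTop_sets.1 hs
      exact measure_mono_top (s₁ := Ici a) ha (by simp)) hlim'
  linarith

/-- Completing the square in the harmonic oscillator energy. -/
theorem energy_eq (h : RealAdmissible f f') :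
    ∫ t in Ioi (0:ℝ), (f' t ^ 2 + (t - ξ) ^ 2 * f t ^ 2)
      = (∫ t in Ioi (0:ℝ), f t ^ 2) + (∫ t in Ioi (0:ℝ), (f' t + (t - ξ) * f t) ^ 2)
        - ξ * f 0 ^ 2 := by
  rw [← h.integral_boundary ξ, ← integral_add h.memL2 (h.integrableOn_annihilation_sq ξ),
    ← integral_sub]
  · congr 1 with t
    ring
  · exact h.memL2.add (h.integrableOn_annihilation_sq ξ)
  · exact h.memL2.add (h.integrableOn_mul_deriv ξ)

theorem mul_gaussian_sub (h : RealAdmissible f f') {x : ℝ} (hx : 0 ≤ x) :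
    ∫ t in (0:ℝ)..x, Real.exp ((t - ξ) ^ 2 / 2) * (f' t + (t - ξ) * f t)
      = Real.exp ((x - ξ) ^ 2 / 2) * f x - Real.exp (ξ ^ 2 / 2) * f 0 := by
  have hd : ∀ t : ℝ, HasDerivAt (fun t => Real.exp ((t - ξ) ^ 2 / 2))
      ((t - ξ) * Real.exp ((t - ξ) ^ 2 / 2)) t := by
    intro t
    convert! ((((hasDerivAt_id t).sub_const ξ).pow 2).div_const 2).exp using 1
    simp
    ring
  have hc : Continuous fun t : ℝ => (t - ξ) * Real.exp ((t - ξ) ^ 2 / 2) := by fun_prop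
  have := integral_mul_primitive (f := fun t => Real.exp ((t - ξ) ^ 2 / 2)) (g := f) hx
    (hc.intervalIntegrable 0 x) (h.locInt x hx)
    (fun t _ => by
      rw [intervalIntegral.integral_eq_sub_of_hasDerivAt (fun t _ => hd t)
        (hc.intervalIntegrable 0 t)]
      ring)
    (fun t ht => h.ac t ht.1)
  simp only [zero_sub, neg_sq] at this
  rw [← this]
  congr 1 with t
  ring

theorem integral_exp_sq_le {x : ℝ} (hξ : 0 < ξ) (hx : 0 ≤ x) (hxξ : x ≤ ξ) :
    ∫ t in (0:ℝ)..x, Real.exp ((t - ξ) ^ 2) ≤ Real.exp (ξ ^ 2) / ξ := by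
  have hd : ∀ t : ℝ, HasDerivAt (fun t => -(Real.exp (ξ ^ 2 - ξ * t) / ξ))
      (Real.exp (ξ ^ 2 - ξ * t)) t := by
    intro t
    convert! ((((hasDerivAt_id t).const_mul ξ).const_sub (ξ ^ 2)).exp.div_const ξ).neg using 1
    simp
    field_simp
  calc ∫ t in (0:ℝ)..x, Real.exp ((t - ξ) ^ 2) ≤ ∫ t in (0:ℝ)..x, Real.exp (ξ ^ 2 - ξ * t) := by
        apply intervalIntegral.integral_mono_on hx
          (Continuous.intervalIntegrable (by fun_prop) _ _)
          (Continuous.intervalIntegrable (by fun_prop) _ _)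
        intro t ht
        apply Real.exp_le_exp.2
        nlinarith [mul_nonneg ht.1 (sub_nonneg.2 (ht.2.trans hxξ))]
    _ = Real.exp (ξ ^ 2) / ξ - Real.exp (ξ ^ 2 - ξ * x) / ξ := by
        rw [intervalIntegral.integral_eq_sub_of_hasDerivAt (fun t _ => hd t)
          (Continuous.intervalIntegrable (by fun_prop) _ _)]
        simp
        ring
    _ ≤ _ := by
        have : 0 < Real.exp (ξ ^ 2 - ξ * x) / ξ := by positivity
        linarith

theorem sq_mul_gaussian_sub_le (h : RealAdmissible f f') {x : ℝ} (hξ : 0 < ξ) (hx : 0 ≤ x)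
    (hxξ : x ≤ ξ) :
    (Real.exp ((x - ξ) ^ 2 / 2) * f x - Real.exp (ξ ^ 2 / 2) * f 0) ^ 2
      ≤ Real.exp (ξ ^ 2) / ξ * ∫ t in Ioi (0:ℝ), (f' t + (t - ξ) * f t) ^ 2 := by
  rw [← h.mul_gaussian_sub ξ hx]
  set B := ∫ t in (0:ℝ)..x, Real.exp ((t - ξ) ^ 2 / 2) * (f' t + (t - ξ) * f t) with hB
  set D := ∫ t in Ioi (0:ℝ), (f' t + (t - ξ) * f t) ^ 2 with hD
  set K := Real.exp (ξ ^ 2) / ξ with hK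
  have hKpos : 0 < K := by positivity
  have hsub : uIcc 0 x ⊆ Ici 0 := by rw [uIcc_of_le hx]; exact Icc_subset_Ici_self
  have hann : IntervalIntegrable (fun t => f' t + (t - ξ) * f t) volume 0 x :=
    (h.locInt x hx).add (ContinuousOn.intervalIntegrable
      ((by fun_prop : Continuous fun t : ℝ => t - ξ).continuousOn.mul (h.continuousOn.mono hsub)))
  have i1 : IntervalIntegrable (fun t => Real.exp ((t - ξ) ^ 2)) volume 0 x :=
    Continuous.intervalIntegrable (by fun_prop) _ _
  have i2 : IntervalIntegrable
      (fun t => Real.exp ((t - ξ) ^ 2 / 2) * (f' t + (t - ξ) * f t)) volume 0 x :=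
    hann.continuousOn_mul (by fun_prop)
  have i3 : IntervalIntegrable (fun t => (f' t + (t - ξ) * f t) ^ 2) volume 0 x := by
    rw [intervalIntegrable_iff_integrableOn_Ioc_of_le hx]
    exact (h.integrableOn_annihilation_sq ξ).mono_set Ioc_subset_Ioi_self
  have hD' : ∫ t in (0:ℝ)..x, (f' t + (t - ξ) * f t) ^ 2 ≤ D := by
    rw [intervalIntegral.integral_of_le hx]
    exact setIntegral_mono_set (h.integrableOn_annihilation_sq ξ)
      (Eventually.of_forall fun t => sq_nonneg _) Ioc_subset_Ioi_self.eventuallyLE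
  have hA := integral_exp_sq_le ξ hξ hx hxξ
  have hnn : 0 ≤ ∫ t in (0:ℝ)..x,
      ((B / K) ^ 2 * Real.exp ((t - ξ) ^ 2)
        - 2 * (B / K) * (Real.exp ((t - ξ) ^ 2 / 2) * (f' t + (t - ξ) * f t))
        + (f' t + (t - ξ) * f t) ^ 2) := by
    apply intervalIntegral.integral_nonneg hx
    intro t _
    have : Real.exp ((t - ξ) ^ 2) = Real.exp ((t - ξ) ^ 2 / 2) ^ 2 := by
      rw [← Real.exp_nat_mul]
      congr 1
      push_cast
      ring
    rw [this]
    nlinarith [sq_nonneg (B / K * Real.exp ((t - ξ) ^ 2 / 2) - (f' t + (t - ξ) * f t))]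
  rw [intervalIntegral.integral_add ((i1.const_mul _).sub (i2.const_mul _)) i3,
    intervalIntegral.integral_sub (i1.const_mul _) (i2.const_mul _),
    intervalIntegral.integral_const_mul, intervalIntegral.integral_const_mul, ← hB] at hnn
  have h1 := mul_le_mul_of_nonneg_left hA (sq_nonneg (B / K))
  have h2 : (B / K) ^ 2 * K = B ^ 2 / K := by field_simp
  have h3 : 2 * (B / K) * B = 2 * (B ^ 2 / K) := by ring
  have h4 : B ^ 2 / K ≤ D := by linarith
  rw [div_le_iff₀ hKpos] at h4
  linarith

/-- A pointwise trace inequality at the boundary point `0`. -/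
theorem sq_zero_le_pointwise (h : RealAdmissible f f') {γ x : ℝ} (hγ : 0 < γ) (hξ : 0 < ξ)
    (hx : 0 ≤ x) (hxξ : x ≤ ξ) (hx1 : ξ - 1 ≤ x) :
    f 0 ^ 2 ≤ (1 + ξ / γ) * Real.exp (1 - ξ ^ 2) * f x ^ 2
      + (1 + γ / ξ) / ξ * ∫ t in Ioi (0:ℝ), (f' t + (t - ξ) * f t) ^ 2 := by
  have h0 := h.sq_mul_gaussian_sub_le ξ hξ hx hxξ
  set D := ∫ t in Ioi (0:ℝ), (f' t + (t - ξ) * f t) ^ 2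
  set a := Real.exp ((x - ξ) ^ 2 / 2) * f x with ha
  set b := Real.exp (ξ ^ 2 / 2) * f 0 with hb
  have hsq : ∀ y : ℝ, Real.exp (y / 2) ^ 2 = Real.exp y := by
    intro y
    rw [← Real.exp_nat_mul]
    congr 1
    push_cast
    ring
  have ha2 : a ^ 2 ≤ Real.exp 1 * f x ^ 2 := by
    rw [ha, mul_pow, hsq]
    gcongr
    nlinarith
  have hb2 : b ^ 2 = Real.exp (ξ ^ 2) * f 0 ^ 2 := by rw [hb, mul_pow, hsq]
  have hab : b ^ 2 ≤ (1 + ξ / γ) * a ^ 2 + (1 + γ / ξ) * (a - b) ^ 2 := by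
    have e : (1 + ξ / γ) * a ^ 2 + (1 + γ / ξ) * (a - b) ^ 2 - b ^ 2
        = (ξ * a + γ * (a - b)) ^ 2 / (γ * ξ) := by
      field_simp
      ring
    have : 0 ≤ (ξ * a + γ * (a - b)) ^ 2 / (γ * ξ) := by positivity
    linarith
  have hmain : Real.exp (ξ ^ 2) * f 0 ^ 2 ≤ (1 + ξ / γ) * (Real.exp 1 * f x ^ 2)
      + (1 + γ / ξ) * (Real.exp (ξ ^ 2) / ξ * D) := by
    rw [← hb2]
    refine hab.trans ?_
    gcongr
  have hE := Real.exp_pos (ξ ^ 2)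
  refine le_of_mul_le_mul_left (hmain.trans (le_of_eq ?_)) hE
  rw [Real.exp_sub]
  field_simp

theorem sq_zero_le (h : RealAdmissible f f') {γ : ℝ} (hγ : 0 < γ) (hξ : 1 ≤ ξ) :
    f 0 ^ 2 ≤ (1 + ξ / γ) * Real.exp (1 - ξ ^ 2) * (∫ t in Ioi (0:ℝ), f t ^ 2)
      + (1 + γ / ξ) / ξ * ∫ t in Ioi (0:ℝ), (f' t + (t - ξ) * f t) ^ 2 := by
  have hle : ξ - 1 ≤ ξ := by linarith
  have hsubset : Ioc (ξ - 1) ξ ⊆ Ioi 0 := fun t ht => by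
    simp only [mem_Ioc, mem_Ioi] at *; linarith
  have hf2 : IntervalIntegrable (fun t => f t ^ 2) volume (ξ - 1) ξ := by
    rw [intervalIntegrable_iff_integrableOn_Ioc_of_le hle]
    exact h.memL2.mono_set hsubset
  have hm := intervalIntegral.integral_mono_on hle (μ := volume) (f := fun _ => f 0 ^ 2)
    (by simp) ((hf2.const_mul ((1 + ξ / γ) * Real.exp (1 - ξ ^ 2))).add
      (intervalIntegrable_const
        (c := (1 + γ / ξ) / ξ * ∫ t in Ioi (0:ℝ), (f' t + (t - ξ) * f t) ^ 2)))
    (fun x hx => h.sq_zero_le_pointwise ξ hγ (by linarith) (by linarith [hx.1]) hx.2 hx.1)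
  rw [intervalIntegral.integral_add (hf2.const_mul _) (by simp),
    intervalIntegral.integral_const_mul] at hm
  simp only [intervalIntegral.integral_const, sub_sub_cancel, one_smul] at hm
  refine hm.trans ?_
  gcongr
  rw [intervalIntegral.integral_of_le hle]
  exact setIntegral_mono_set h.memL2
    (Eventually.of_forall fun t => sq_nonneg _) hsubset.eventuallyLE

end RealAdmissible

theorem sq_mul_exp_neg_sq_anti {γ ξ : ℝ} (hγ : 1 ≤ γ) (h : γ ≤ ξ) :
    ξ ^ 2 * Real.exp (-ξ ^ 2) ≤ γ ^ 2 * Real.exp (-γ ^ 2) := by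
  have h1 : ξ ^ 2 / γ ^ 2 ≤ Real.exp (ξ ^ 2 - γ ^ 2) := by
    refine le_trans ?_ (Real.add_one_le_exp _)
    rw [div_le_iff₀ (by positivity)]
    nlinarith [mul_nonneg (by nlinarith : 0 ≤ ξ ^ 2 - γ ^ 2) (by nlinarith : 0 ≤ γ ^ 2 - 1)]
  rw [div_le_iff₀ (by positivity)] at h1
  calc ξ ^ 2 * Real.exp (-ξ ^ 2) ≤ Real.exp (ξ ^ 2 - γ ^ 2) * γ ^ 2 * Real.exp (-ξ ^ 2) := by gcongr
    _ = γ ^ 2 * (Real.exp (ξ ^ 2 - γ ^ 2) * Real.exp (-ξ ^ 2)) := by ring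
    _ = _ := by
      rw [← Real.exp_add]
      congr 2
      ring

/-- Lower bound for the energy of real-valued functions. -/
theorem RealAdmissible.energy_ge {f f' : ℝ → ℝ} (h : RealAdmissible f f') {γ : ℝ} (hγ : 1 ≤ γ)
    (ξ : ℝ) :
    (1 - Real.exp 1 * γ * Real.exp (-γ ^ 2)) * (∫ t in Ioi (0:ℝ), f t ^ 2)
      ≤ (∫ t in Ioi (0:ℝ), (f' t ^ 2 + (t - ξ) ^ 2 * f t ^ 2)) + γ * f 0 ^ 2 := by
  rw [h.energy_eq ξ]
  have hD : 0 ≤ ∫ t in Ioi (0:ℝ), (f' t + (t - ξ) * f t) ^ 2 := integral_nonneg fun t => sq_nonneg _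
  have hN : 0 ≤ ∫ t in Ioi (0:ℝ), f t ^ 2 := integral_nonneg fun t => sq_nonneg _
  have hγ0 : 0 < γ := by linarith
  rcases le_total ξ γ with hle | hle
  · have h1 := mul_nonneg (sub_nonneg.2 hle) (sq_nonneg (f 0))
    have h2 : 0 ≤ Real.exp 1 * γ * Real.exp (-γ ^ 2) * ∫ t in Ioi (0:ℝ), f t ^ 2 := by
      positivity
    linarith
  · have hξ : 0 < ξ := by linarith
    have h0 := mul_le_mul_of_nonneg_left (h.sq_zero_le ξ hγ0 (hγ.trans hle)) (sub_nonneg.2 hle)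
    set D := ∫ t in Ioi (0:ℝ), (f' t + (t - ξ) * f t) ^ 2
    set N := ∫ t in Ioi (0:ℝ), f t ^ 2
    have h1 : (ξ - γ) * ((1 + γ / ξ) / ξ) ≤ 1 := by
      have : (ξ - γ) * ((1 + γ / ξ) / ξ) = 1 - γ ^ 2 / ξ ^ 2 := by
        field_simp
        ring
      rw [this]
      linarith [div_nonneg (sq_nonneg γ) (sq_nonneg ξ)]
    have h2 : (ξ - γ) * ((1 + ξ / γ) * Real.exp (1 - ξ ^ 2))
        ≤ Real.exp 1 * γ * Real.exp (-γ ^ 2) := by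
      have h3 : (ξ - γ) * (1 + ξ / γ) ≤ ξ ^ 2 / γ := by
        have : (ξ - γ) * (1 + ξ / γ) = ξ ^ 2 / γ - γ := by
          field_simp
          ring
        linarith
      calc (ξ - γ) * ((1 + ξ / γ) * Real.exp (1 - ξ ^ 2))
          = (ξ - γ) * (1 + ξ / γ) * (Real.exp 1 * Real.exp (-ξ ^ 2)) := by
            rw [← Real.exp_add, ← sub_eq_add_neg, mul_assoc]
        _ ≤ ξ ^ 2 / γ * (Real.exp 1 * Real.exp (-ξ ^ 2)) := by gcongr
        _ = Real.exp 1 / γ * (ξ ^ 2 * Real.exp (-ξ ^ 2)) := by ring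
        _ ≤ Real.exp 1 / γ * (γ ^ 2 * Real.exp (-γ ^ 2)) := by
            exact mul_le_mul_of_nonneg_left (sq_mul_exp_neg_sq_anti hγ hle) (by positivity)
        _ = Real.exp 1 * γ * Real.exp (-γ ^ 2) := by field_simp
    have h4 := mul_le_mul_of_nonneg_right h1 hD
    have h5 := mul_le_mul_of_nonneg_right h2 hN
    linarith

namespace AdmissibleHL

variable {u u' : ℝ → ℂ}

/-- Applying a contractive real-linear functional to an admissible function. -/
theorem realAdmissible_comp (h : AdmissibleHL u u') (L : ℂ →L[ℝ] ℝ) (hL : ∀ z, |L z| ≤ ‖z‖) :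
    RealAdmissible (fun t => L (u t)) (fun t => L (u' t)) := by
  have hsq : ∀ z, L z ^ 2 ≤ ‖z‖ ^ 2 := fun z => by
    rw [← sq_abs (L z)]
    exact pow_le_pow_left₀ (abs_nonneg _) (hL z) 2
  have hmu : AEStronglyMeasurable (fun t => L (u t)) (volume.restrict (Ioi 0)) :=
    L.continuous.comp_aestronglyMeasurable
      ((h.cont.mono Ioi_subset_Ici_self).aestronglyMeasurable measurableSet_Ioi)
  have hmu' : AEStronglyMeasurable (fun t => L (u' t)) (volume.restrict (Ioi 0)) :=
    L.continuous.comp_aestronglyMeasurable (aestronglyMeasurable_Ioi_of_locInt h.locInt)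
  refine ⟨fun t ht => ?_, fun t ht => ?_, ?_, ?_, ?_⟩
  · have := h.locInt t ht
    rw [intervalIntegrable_iff] at this ⊢
    exact L.integrable_comp this
  · rw [L.intervalIntegral_comp_comm (h.locInt t ht), ← map_add, ← h.ac t ht]
  · refine h.memL2.mono' (hmu.pow 2) (Eventually.of_forall fun t => ?_)
    rw [Real.norm_of_nonneg (sq_nonneg _)]
    exact hsq _
  · refine h.memL2'.mono' (hmu'.pow 2) (Eventually.of_forall fun t => ?_)
    rw [Real.norm_of_nonneg (sq_nonneg _)]
    exact hsq _
  · refine h.memL2t.mono' ((continuous_id.pow 2).aestronglyMeasurable.mul (hmu.pow 2))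
      (Eventually.of_forall fun t => ?_)
    rw [Real.norm_of_nonneg (by positivity)]
    exact mul_le_mul_of_nonneg_left (hsq _) (sq_nonneg _)

theorem re (h : AdmissibleHL u u') :
    RealAdmissible (fun t => (u t).re) (fun t => (u' t).re) :=
  h.realAdmissible_comp Complex.reCLM Complex.abs_re_le_norm

theorem im (h : AdmissibleHL u u') :
    RealAdmissible (fun t => (u t).im) (fun t => (u' t).im) :=
  h.realAdmissible_comp Complex.imCLM Complex.abs_im_le_norm

theorem integral_norm_sq_pos (h : AdmissibleHL u u') (hne : ∃ t ∈ Ici (0:ℝ), u t ≠ 0) :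
    0 < ∫ t in Ioi (0:ℝ), ‖u t‖ ^ 2 := by
  obtain ⟨t, ht, hut⟩ := hne
  rw [integral_pos_iff_support_of_nonneg (fun t => sq_nonneg _) h.memL2]
  have hev : ∀ᶠ s in nhdsWithin t (Ioi t), u s ≠ 0 :=
    ((h.cont t ht).mono (Ioi_subset_Ici ht)).eventually_ne hut
  obtain ⟨b, hb, hsub⟩ := mem_nhdsGT_iff_exists_Ioo_subset.1 hev
  rw [Measure.restrict_apply' measurableSet_Ioi]
  refine lt_of_lt_of_le ?_ (measure_mono (s := Ioo t b) fun s hs => ⟨?_, ?_⟩)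
  · simpa using hb
  · simpa using hsub hs
  · exact lt_of_le_of_lt ht hs.1

theorem qform_ge (h : AdmissibleHL u u') {γ : ℝ} (hγ : 1 ≤ γ) (ξ : ℝ) :
    (1 - Real.exp 1 * γ * Real.exp (-γ ^ 2)) * (∫ t in Ioi (0:ℝ), ‖u t‖ ^ 2)
      ≤ qform γ ξ u u' := by
  have hn : ∀ z : ℂ, ‖z‖ ^ 2 = z.re ^ 2 + z.im ^ 2 := fun z => by
    rw [Complex.sq_norm, Complex.normSq_apply]
    ring
  have hN : ∫ t in Ioi (0:ℝ), ‖u t‖ ^ 2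
      = (∫ t in Ioi (0:ℝ), (u t).re ^ 2) + ∫ t in Ioi (0:ℝ), (u t).im ^ 2 := by
    rw [← integral_add h.re.memL2 h.im.memL2]
    simp only [hn]
  have hQ : ∫ t in Ioi (0:ℝ), (‖u' t‖ ^ 2 + (t - ξ) ^ 2 * ‖u t‖ ^ 2)
      = (∫ t in Ioi (0:ℝ), ((u' t).re ^ 2 + (t - ξ) ^ 2 * (u t).re ^ 2))
        + ∫ t in Ioi (0:ℝ), ((u' t).im ^ 2 + (t - ξ) ^ 2 * (u t).im ^ 2) := by
    rw [← integral_add]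
    · congr 1 with t
      rw [hn, hn]
      ring
    · exact h.re.memL2'.add (h.re.integrableOn_shift_sq ξ)
    · exact h.im.memL2'.add (h.im.integrableOn_shift_sq ξ)
  rw [qform, hN, hQ, hn (u 0)]
  have h1 := h.re.energy_ge hγ ξ
  have h2 := h.im.energy_ge hγ ξ
  linarith

end AdmissibleHL

theorem realAdmissible_gaussian (ξ : ℝ) :
    RealAdmissible (fun t => Real.exp (-(t - ξ) ^ 2 / 2))
      (fun t => -(t - ξ) * Real.exp (-(t - ξ) ^ 2 / 2)) := by
  have hd : ∀ t : ℝ, HasDerivAt (fun t => Real.exp (-(t - ξ) ^ 2 / 2))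
      (-(t - ξ) * Real.exp (-(t - ξ) ^ 2 / 2)) t := by
    intro t
    convert! ((((hasDerivAt_id t).sub_const ξ).pow 2).neg.div_const 2).exp using 1
    simp
    ring
  have hsq : ∀ t : ℝ, Real.exp (-(t - ξ) ^ 2 / 2) ^ 2 = Real.exp (-(t - ξ) ^ 2) := fun t => by
    rw [← Real.exp_nat_mul]
    congr 1
    push_cast
    ring
  have hc : Continuous fun t : ℝ => -(t - ξ) * Real.exp (-(t - ξ) ^ 2 / 2) := by fun_prop
  have h0 : Integrable fun t : ℝ => Real.exp (-(t - ξ) ^ 2) := by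
    simpa using (integrable_exp_neg_mul_sq one_pos).comp_sub_right ξ
  have h2 : Integrable fun t : ℝ => (t - ξ) ^ 2 * Real.exp (-(t - ξ) ^ 2) := by
    simpa using (integrable_rpow_mul_exp_neg_mul_sq one_pos
      (by norm_num : (-1:ℝ) < 2)).comp_sub_right ξ
  refine ⟨fun t _ => hc.intervalIntegrable _ _, fun t _ => ?_, ?_, ?_, ?_⟩
  · rw [intervalIntegral.integral_eq_sub_of_hasDerivAt (fun t _ => hd t)
      (hc.intervalIntegrable 0 t)]
    ring
  · simpa only [hsq] using h0.integrableOn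
  · simpa only [mul_pow, neg_sq, hsq] using h2.integrableOn
  · simp only [hsq]
    refine Integrable.integrableOn (((h2.const_mul 2).add (h0.const_mul (2 * ξ ^ 2))).mono'
      (by fun_prop) (Eventually.of_forall fun t => ?_))
    rw [Real.norm_of_nonneg (by positivity)]
    simp only [Pi.add_apply]
    nlinarith [mul_nonneg (sq_nonneg (t - 2 * ξ)) (Real.exp_pos (-(t - ξ) ^ 2)).le]

theorem RealAdmissible.ofReal {f f' : ℝ → ℝ} (h : RealAdmissible f f') :
    AdmissibleHL (fun t => (f t : ℂ)) (fun t => (f' t : ℂ)) where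
  cont := Complex.continuous_ofReal.comp_continuousOn h.continuousOn
  locInt t ht := by
    have := h.locInt t ht
    rw [intervalIntegrable_iff] at this ⊢
    exact Integrable.ofReal this
  ac t ht := by
    rw [intervalIntegral.integral_ofReal, ← Complex.ofReal_add, ← h.ac t ht]
  memL2 := by simpa using h.memL2
  memL2' := by simpa using h.memL2'
  memL2t := by simpa using h.memL2t

/-- The Rayleigh quotients of the form `q[γ,ξ]`. -/
def rayleighQuotients (γ ξ : ℝ) : Set ℝ :=
  { r : ℝ | ∃ u u' : ℝ → ℂ, AdmissibleHL u u' ∧ (∃ t ∈ Ici (0:ℝ), u t ≠ 0) ∧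
    r = qform γ ξ u u' / ∫ t in Ioi (0:ℝ), ‖u t‖ ^ 2 }

theorem le_of_mem_rayleighQuotients {γ ξ r : ℝ} (hγ : 1 ≤ γ) (hr : r ∈ rayleighQuotients γ ξ) :
    1 - Real.exp 1 * γ * Real.exp (-γ ^ 2) ≤ r := by
  obtain ⟨u, u', h, hne, rfl⟩ := hr
  rw [le_div_iff₀ (h.integral_norm_sq_pos hne)]
  exact h.qform_ge hγ ξ

theorem exists_mem_rayleighQuotients (γ ξ : ℝ) :
    ∃ c > 0, 1 + (γ - ξ) * c ∈ rayleighQuotients γ ξ := by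
  have hg := realAdmissible_gaussian ξ
  have hne : ∃ t ∈ Ici (0:ℝ), ((Real.exp (-(t - ξ) ^ 2 / 2) : ℝ) : ℂ) ≠ 0 :=
    ⟨0, self_mem_Ici, by exact_mod_cast (Real.exp_pos _).ne'⟩
  have hN := hg.ofReal.integral_norm_sq_pos hne
  refine ⟨Real.exp (-(0 - ξ) ^ 2 / 2) ^ 2 / ∫ t in Ioi (0:ℝ),
    ‖((Real.exp (-(t - ξ) ^ 2 / 2) : ℝ) : ℂ)‖ ^ 2, by positivity, _, _, hg.ofReal, hne, ?_⟩
  have he := hg.energy_eq ξ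
  simp only [qform, Complex.norm_real, Real.norm_eq_abs, sq_abs] at hN ⊢
  rw [he]
  have hz : ∀ t : ℝ, (-(t - ξ) * Real.exp (-(t - ξ) ^ 2 / 2)
      + (t - ξ) * Real.exp (-(t - ξ) ^ 2 / 2)) ^ 2 = 0 := fun t => by ring
  simp only [hz, integral_zero]
  rw [eq_div_iff hN.ne', add_mul, mul_assoc, div_mul_cancel₀ _ hN.ne']
  ring

theorem mu1_ge {γ : ℝ} (hγ : 1 ≤ γ) (ξ : ℝ) :
    1 - Real.exp 1 * γ * Real.exp (-γ ^ 2) ≤ mu1 γ ξ := by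
  obtain ⟨c, _, hc⟩ := exists_mem_rayleighQuotients γ ξ
  exact le_csInf (s := rayleighQuotients γ ξ) ⟨_, hc⟩ fun r hr => le_of_mem_rayleighQuotients hγ hr

theorem mu1_add_one_lt {γ : ℝ} (hγ : 1 ≤ γ) : mu1 γ (γ + 1) < 1 := by
  obtain ⟨c, hc0, hc⟩ := exists_mem_rayleighQuotients γ (γ + 1)
  have h : mu1 γ (γ + 1) ≤ 1 + (γ - (γ + 1)) * c :=
    csInf_le (s := rayleighQuotients γ (γ + 1))
      ⟨_, fun r hr => le_of_mem_rayleighQuotients hγ hr⟩ hc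
  linarith

/-- There exist `C₀ > 0` and `γ₀ > 0` such that for all `γ ≥ γ₀`,
`1 − C₀·γ·exp(−γ²) ≤ Θ(γ) < 1`. -/
theorem Theta_pos_asymptotics :
    ∃ C₀ > (0:ℝ), ∃ γ₀ > (0:ℝ), ∀ γ : ℝ, γ₀ ≤ γ →
      1 - C₀ * γ * Real.exp (-γ ^ 2) ≤ Theta γ ∧ Theta γ < 1 := by
  refine ⟨Real.exp 1, Real.exp_pos 1, 1, one_pos, fun γ hγ => ⟨le_ciInf (mu1_ge hγ), ?_⟩⟩
  have hbdd : BddBelow (range (mu1 γ)) := ⟨_, forall_mem_range.2 (mu1_ge hγ)⟩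
  exact (ciInf_le hbdd (γ + 1)).trans_lt (mu1_add_one_lt hγ)
end

section
/- For each ε ∈ (0,1) there exists a constant C_ε > 0 such that for every γ ∈ ℝ, every ξ* ∈ ℝ with μ⁽¹⁾(γ,ξ*) = Θ(γ) and ξ*² = Θ(γ) + γ², and every twice continuously differentiable function φ : [0,∞) → ℝ with φ > 0, ∫₀^∞ φ(t)² dt = 1, with φ, φ', and t²·φ(t) in L²((0,∞)), satisfying −φ''(t) + (t−ξ*)²φ(t) = Θ(γ)·φ(t) for all t ≥ 0 and φ'(0) = γ·φ(0), one has ∫_{\{t ≥ 0 : t−ξ* ≥ C_ε\}} exp(ε(t−ξ*)²)·(|φ'(t)|² + |φ(t)|²) dt ≤ C_ε²·(1 + γ₋ + γ₋²)², where γ₋ = max(−γ, 0). -/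
open MeasureTheory Set Filter

/-- A function that is integrable on the half-line drops below any positive level
arbitrarily far out. -/
theorem exists_lt_of_integrableOn_Ioi_s18 {h : ℝ → ℝ} (hh : IntegrableOn h (Ioi 0)) {a c : ℝ}
    (ha : 0 ≤ a) (hc : 0 < c) : ∃ t ≥ a, h t < c := by
  by_contra! hcon
  have h1 : IntegrableOn (fun _ : ℝ => c) (Ioi a) := by
    refine Integrable.mono' (hh.mono_set (Ioi_subset_Ioi ha)) (by fun_prop) ?_
    refine (ae_restrict_iff' measurableSet_Ioi).2 (ae_of_all _ fun t ht => ?_)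
    rw [Real.norm_of_nonneg hc.le]
    exact hcon t (le_of_lt ht)
  rw [integrableOn_const_iff] at h1
  simp [hc.ne'] at h1

theorem monotoneOn_Ici_of_hasDerivWithinAt {f f' : ℝ → ℝ}
    (hf : ∀ t ∈ Ici (0:ℝ), HasDerivWithinAt f (f' t) (Ici 0) t) {a : ℝ} (ha : 0 ≤ a)
    (hf' : ∀ t, a ≤ t → 0 ≤ f' t) : MonotoneOn f (Ici a) := by
  have hsub : Ici a ⊆ Ici (0:ℝ) := Ici_subset_Ici.2 ha
  refine monotoneOn_of_hasDerivWithinAt_nonneg (f' := f') (convex_Ici a)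
    (fun t ht => ((hf t (hsub ht)).mono hsub).continuousWithinAt)
    (fun t ht => (hf t (hsub (interior_subset ht))).mono (interior_subset.trans hsub))
    (fun t ht => hf' t (interior_subset ht))

theorem antitoneOn_Ici_of_hasDerivWithinAt {f f' : ℝ → ℝ}
    (hf : ∀ t ∈ Ici (0:ℝ), HasDerivWithinAt f (f' t) (Ici 0) t) {a : ℝ} (ha : 0 ≤ a)
    (hf' : ∀ t, a ≤ t → f' t ≤ 0) : AntitoneOn f (Ici a) := by
  have h := monotoneOn_Ici_of_hasDerivWithinAt (f := -f) (f' := fun t => -f' t)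
    (fun t ht => (hf t ht).neg) ha (fun t ht => neg_nonneg.2 (hf' t ht))
  simpa using h.neg

/-- The Gaussian `exp (-(t - ξ)² / 2)`, the ground state of the harmonic oscillator
centred at `ξ`. -/
noncomputable def gaussianAt (ξ t : ℝ) : ℝ := Real.exp (-((t - ξ) ^ 2 / 2))

theorem gaussianAt_pos (ξ t : ℝ) : 0 < gaussianAt ξ t := Real.exp_pos _

theorem gaussianAt_le_one (ξ t : ℝ) : gaussianAt ξ t ≤ 1 := by
  unfold gaussianAt
  rw [Real.exp_le_one_iff]
  nlinarith [sq_nonneg (t - ξ)]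

theorem sq_mul_gaussianAt_sq_le_one (ξ t : ℝ) : (t - ξ) ^ 2 * gaussianAt ξ t ^ 2 ≤ 1 := by
  have h2 : gaussianAt ξ t ^ 2 * Real.exp ((t - ξ) ^ 2) = 1 := by
    unfold gaussianAt
    rw [← Real.exp_nat_mul, ← Real.exp_add, Real.exp_eq_one_iff]
    push_cast
    ring
  have h1 := Real.add_one_le_exp ((t - ξ) ^ 2)
  nlinarith [sq_nonneg (gaussianAt ξ t)]

theorem hasDerivAt_gaussianAt (ξ t : ℝ) :
    HasDerivAt (gaussianAt ξ) (-(t - ξ) * gaussianAt ξ t) t := by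
  have h : HasDerivAt (fun t : ℝ => -((t - ξ) ^ 2 / 2)) (-(t - ξ)) t := by
    exact ((((hasDerivAt_id t).sub_const ξ).pow 2).div_const 2).neg.congr_deriv (by simp)
  exact h.exp.congr_deriv (mul_comm _ _)

namespace IsGroundState

variable {γ ξ μ : ℝ} {φ φ' φ'' : ℝ → ℝ}

theorem center_pos (h : IsGroundState γ ξ μ φ φ' φ'') (hξ : ξ ^ 2 = μ + γ ^ 2) : 0 < ξ := by
  by_contra! hneg
  set F : ℝ → ℝ := fun t => φ' t ^ 2 - ((t - ξ) ^ 2 - μ) * φ t ^ 2 with hF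
  have hderiv : ∀ t ∈ Ici (0:ℝ),
      HasDerivWithinAt F (-2 * (t - ξ) * φ t ^ 2) (Ici 0) t := by
    intro t ht
    have hx : HasDerivWithinAt (fun t : ℝ => (t - ξ) ^ 2 - μ) (2 * (t - ξ)) (Ici 0) t := by
      exact ((((hasDerivWithinAt_id t (Ici 0)).sub_const ξ).pow 2).sub_const μ).congr_deriv
        (by simp)
    refine (((h.deriv2 t ht).pow 2).sub (hx.mul ((h.deriv1 t ht).pow 2))).congr_deriv ?_
    have he : φ'' t = (t - ξ) ^ 2 * φ t - μ * φ t := by linarith [h.eqn t ht]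
    simp only [he, Nat.cast_ofNat, Nat.add_one_sub_one, pow_one, Pi.pow_apply]
    ring
  have hanti : AntitoneOn F (Ici 0) := antitoneOn_Ici_of_hasDerivWithinAt hderiv le_rfl
    (fun t ht => by nlinarith [mul_nonneg (by linarith : 0 ≤ t - ξ) (sq_nonneg (φ t))])
  have hF0 : F 0 = 0 := by
    simp only [hF, h.bc]
    linear_combination (- φ 0 ^ 2) * hξ
  have hint : IntegrableOn
      (fun t => φ' t ^ 2 + (2 + 2 * ξ ^ 2 + |μ|) * φ t ^ 2 + 2 * (t ^ 2 * φ t) ^ 2)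
      (Ioi 0) :=
    (h.memL2'.add (h.memL2.const_mul _)).add (h.memL2t.const_mul _)
  have hFzero : ∀ t ∈ Ici (0:ℝ), F t = 0 := by
    intro a ha
    refine le_antisymm (hF0 ▸ hanti self_mem_Ici ha ha) ?_
    by_contra! hlt
    obtain ⟨t, hta, ht⟩ := exists_lt_of_integrableOn_Ioi_s18 hint ha (neg_pos.2 hlt)
    have h1 : F t ≤ F a := hanti ha (le_trans ha hta) hta
    have h2 : (t - ξ) ^ 2 * φ t ^ 2 ≤ (2 + 2 * ξ ^ 2) * φ t ^ 2 + 2 * (t ^ 2 * φ t) ^ 2 := by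
      have : (t - ξ) ^ 2 ≤ 2 + 2 * ξ ^ 2 + 2 * (t ^ 2) ^ 2 := by
        nlinarith [sq_nonneg (t + ξ), sq_nonneg (t ^ 2 - 1), sq_nonneg (t ^ 2)]
      nlinarith [mul_le_mul_of_nonneg_right this (sq_nonneg (φ t))]
    have h3 : -|μ| * φ t ^ 2 ≤ μ * φ t ^ 2 :=
      mul_le_mul_of_nonneg_right (neg_abs_le μ) (sq_nonneg _)
    have h4 := sq_nonneg (φ' t)
    simp only [hF] at h1 ht
    nlinarith
  have hd := (hderiv 1 (by simp)).hasDerivAt (Ici_mem_nhds one_pos)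
  have hz : HasDerivAt F 0 1 :=
    (hasDerivAt_const (1:ℝ) (0:ℝ)).congr_of_eventuallyEq
      (by filter_upwards [Ici_mem_nhds (one_pos : (0:ℝ) < 1)] with t ht using hFzero t ht)
  have h0 := hd.unique hz
  have hp := h.pos 1 (by simp)
  have : 0 < (1 - ξ) * φ 1 ^ 2 := mul_pos (by linarith) (by positivity)
  linarith

/-- The Wronskian of the ground state with the Gaussian. -/
theorem hasDerivWithinAt_wronskian (h : IsGroundState γ ξ μ φ φ' φ'') :
    ∀ t ∈ Ici (0:ℝ), HasDerivWithinAt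
      (fun t => φ' t * gaussianAt ξ t + φ t * ((t - ξ) * gaussianAt ξ t))
      ((1 - μ) * (φ t * gaussianAt ξ t)) (Ici 0) t := by
  intro t ht
  have hg := (hasDerivAt_gaussianAt ξ t).hasDerivWithinAt (s := Ici 0)
  have hx := (hasDerivWithinAt_id t (Ici 0)).sub_const ξ
  refine (((h.deriv2 t ht).mul hg).add ((h.deriv1 t ht).mul (hx.mul hg))).congr_deriv ?_
  have he : φ'' t = (t - ξ) ^ 2 * φ t - μ * φ t := by linarith [h.eqn t ht]
  simp only [he, id, Pi.mul_apply]
  ring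

theorem exists_sq_wronskian_lt (h : IsGroundState γ ξ μ φ φ' φ'') {a c : ℝ} (ha : 0 ≤ a)
    (hc : 0 < c) :
    ∃ t ≥ a, (φ' t * gaussianAt ξ t + φ t * ((t - ξ) * gaussianAt ξ t)) ^ 2 < c := by
  obtain ⟨t, hta, ht⟩ := exists_lt_of_integrableOn_Ioi_s18
    ((h.memL2'.const_mul 2).add (h.memL2.const_mul 2)) ha hc
  refine ⟨t, hta, lt_of_le_of_lt ?_ ht⟩
  have hg1 : gaussianAt ξ t ^ 2 ≤ 1 :=
    pow_le_one₀ (gaussianAt_pos ξ t).le (gaussianAt_le_one ξ t)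
  have h1 := mul_le_mul_of_nonneg_left hg1 (sq_nonneg (φ' t))
  have h2 := mul_le_mul_of_nonneg_left (sq_mul_gaussianAt_sq_le_one ξ t) (sq_nonneg (φ t))
  change _ ≤ 2 * φ' t ^ 2 + 2 * φ t ^ 2
  nlinarith [sq_nonneg (φ' t * gaussianAt ξ t - φ t * ((t - ξ) * gaussianAt ξ t))]

theorem energy_le_one (h : IsGroundState γ ξ μ φ φ' φ'') (hξ : ξ ^ 2 = μ + γ ^ 2) : μ ≤ 1 := by
  by_contra! hμ
  have hpos := h.center_pos hξ
  have hγ : γ < ξ := by nlinarith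
  have hanti := antitoneOn_Ici_of_hasDerivWithinAt h.hasDerivWithinAt_wronskian le_rfl
    (fun t ht => mul_nonpos_of_nonpos_of_nonneg (by linarith)
      (mul_pos (h.pos t ht) (gaussianAt_pos ξ t)).le)
  have hW0 : φ' 0 * gaussianAt ξ 0 + φ 0 * ((0 - ξ) * gaussianAt ξ 0) < 0 := by
    rw [h.bc]
    nlinarith [mul_pos (sub_pos.2 hγ) (mul_pos (h.pos 0 self_mem_Ici) (gaussianAt_pos ξ 0))]
  obtain ⟨t, ht0, ht⟩ := h.exists_sq_wronskian_lt le_rfl (pow_pos (neg_pos.2 hW0) 2)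
  have h1 := hanti self_mem_Ici ht0 ht0
  simp only at h1
  nlinarith

theorem deriv_le (h : IsGroundState γ ξ μ φ φ' φ'') (hμ : μ ≤ 1) {a : ℝ} (ha : 0 ≤ a) :
    φ' a ≤ -(a - ξ) * φ a := by
  by_contra! hlt
  have hmono := monotoneOn_Ici_of_hasDerivWithinAt h.hasDerivWithinAt_wronskian le_rfl
    (fun t ht => mul_nonneg (by linarith) (mul_pos (h.pos t ht) (gaussianAt_pos ξ t)).le)
  have hWa : 0 < φ' a * gaussianAt ξ a + φ a * ((a - ξ) * gaussianAt ξ a) := by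
    nlinarith [mul_pos (sub_pos.2 hlt) (gaussianAt_pos ξ a)]
  obtain ⟨t, hta, ht⟩ := h.exists_sq_wronskian_lt ha (pow_pos hWa 2)
  have h1 := hmono ha (le_trans ha hta) hta
  simp only at h1
  nlinarith

theorem antitoneOn_Ici_center (h : IsGroundState γ ξ μ φ φ' φ'') (hμ : μ ≤ 1) (hξ : 0 ≤ ξ) :
    AntitoneOn φ (Ici ξ) :=
  antitoneOn_Ici_of_hasDerivWithinAt h.deriv1 hξ fun t ht => by
    have h1 := h.deriv_le hμ (hξ.trans ht)
    nlinarith [mul_nonneg (sub_nonneg.2 ht) (h.pos t (hξ.trans ht)).le]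

theorem apply_center_add_one_le (h : IsGroundState γ ξ μ φ φ' φ'') (hμ : μ ≤ 1) (hξ : 0 ≤ ξ) :
    φ (ξ + 1) ≤ 1 := by
  have hp := h.pos (ξ + 1) (by simp only [mem_Ici]; linarith)
  have hsub : Ioc ξ (ξ + 1) ⊆ Ioi 0 := fun t ht => hξ.trans_lt ht.1
  have h1 : ∫ _ in Ioc ξ (ξ + 1), φ (ξ + 1) ^ 2 ≤ ∫ t in Ioc ξ (ξ + 1), φ t ^ 2 := by
    refine setIntegral_mono_on (by simp) (h.memL2.mono_set hsub) measurableSet_Ioc ?_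
    intro t ht
    exact pow_le_pow_left₀ hp.le (h.antitoneOn_Ici_center hμ hξ ht.1.le
      (by simp) ht.2) 2
  have h2 : ∫ t in Ioc ξ (ξ + 1), φ t ^ 2 ≤ ∫ t in Ioi (0:ℝ), φ t ^ 2 :=
    setIntegral_mono_set h.memL2 (ae_of_all _ fun t => sq_nonneg _) hsub.eventuallyLE
  rw [h.normalized] at h2
  simp at h1
  nlinarith

theorem apply_le (h : IsGroundState γ ξ μ φ φ' φ'') (hμ : μ ≤ 1) (hξ : 0 ≤ ξ) {t : ℝ}
    (ht : 1 ≤ t - ξ) : φ t ≤ Real.exp (1 / 2 - (t - ξ) ^ 2 / 2) := by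
  have hexp : ∀ t : ℝ, HasDerivAt (fun t => Real.exp ((t - ξ) ^ 2 / 2))
      ((t - ξ) * Real.exp ((t - ξ) ^ 2 / 2)) t := by
    intro t
    have h1 : HasDerivAt (fun t : ℝ => (t - ξ) ^ 2 / 2) (t - ξ) t := by
      exact ((((hasDerivAt_id t).sub_const ξ).pow 2).div_const 2).congr_deriv (by simp)
    exact h1.exp.congr_deriv (mul_comm _ _)
  have hanti : AntitoneOn (fun t => φ t * Real.exp ((t - ξ) ^ 2 / 2)) (Ici 0) := by
    refine antitoneOn_Ici_of_hasDerivWithinAt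
      (fun t ht => (h.deriv1 t ht).mul (hexp t).hasDerivWithinAt) le_rfl fun t ht => ?_
    have h1 := h.deriv_le hμ ht
    nlinarith [mul_le_mul_of_nonneg_right h1 (Real.exp_pos ((t - ξ) ^ 2 / 2)).le]
  have h2 := hanti (show ξ + 1 ∈ Ici 0 by simp only [mem_Ici]; linarith)
    (show t ∈ Ici 0 by simp only [mem_Ici]; linarith) (by linarith)
  simp only [add_sub_cancel_left, one_pow] at h2
  rw [Real.exp_sub, le_div_iff₀ (Real.exp_pos _)]
  refine h2.trans ?_
  exact mul_le_of_le_one_left (Real.exp_pos _).le (h.apply_center_add_one_le hμ hξ)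

theorem abs_deriv_le (h : IsGroundState γ ξ μ φ φ' φ'') (hμ : μ ≤ 1) (hξ : 0 ≤ ξ) {t : ℝ}
    (ht : 2 ≤ t - ξ) : |φ' t| ≤ Real.exp (1 / 2 - (t - 1 - ξ) ^ 2 / 2) := by
  have ht0 : 0 ≤ t := by linarith
  have hnonpos : φ' t ≤ 0 := by
    have h1 := h.deriv_le hμ ht0
    nlinarith [mul_nonneg (by linarith : 0 ≤ t - ξ) (h.pos t ht0).le]
  have hmono : MonotoneOn φ' (Ici (ξ + 1)) :=
    monotoneOn_Ici_of_hasDerivWithinAt h.deriv2 (by linarith) fun s hs => by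
      have h1 := h.eqn s (by simp only [mem_Ici]; linarith)
      have h2 : 0 ≤ (s - ξ) ^ 2 - μ := by nlinarith
      nlinarith [mul_nonneg h2 (h.pos s (by simp only [mem_Ici]; linarith)).le]
  obtain ⟨c, hc, hceq⟩ := exists_hasDerivAt_eq_slope φ φ' (by linarith : t - 1 < t)
    (fun s hs => ((h.deriv1 s (by simp only [mem_Ici]; linarith [hs.1])).continuousWithinAt).mono
      fun r hr => by simp only [mem_Ici]; linarith [hr.1])
    (fun s hs => (h.deriv1 s (by simp only [mem_Ici]; linarith [hs.1])).hasDerivAt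
      (Ici_mem_nhds (by linarith [hs.1])))
  have hct : φ' c ≤ φ' t := hmono (by simp only [mem_Ici]; linarith [hc.1])
    (by simp only [mem_Ici]; linarith) hc.2.le
  have hslope : φ' c = φ t - φ (t - 1) := by rw [hceq]; simp
  rw [abs_of_nonpos hnonpos]
  refine le_trans ?_ (h.apply_le hμ hξ (t := t - 1) (by linarith))
  linarith [h.pos t ht0]

theorem weighted_density_le (h : IsGroundState γ ξ μ φ φ' φ'') (hμ : μ ≤ 1) (hξ : 0 ≤ ξ)
    {ε t : ℝ} (hε : ε < 1) (ht : 2 ≤ t - ξ) :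
    Real.exp (ε * (t - ξ) ^ 2) * (φ' t ^ 2 + φ t ^ 2) ≤
      2 * Real.exp (2 / (1 - ε)) * Real.exp (-((1 - ε) / 2) * (t - ξ) ^ 2) := by
  set x := t - ξ with hx
  have hsq : ∀ y : ℝ, |y| ≤ Real.exp (1 / 2 - (x - 1) ^ 2 / 2) →
      y ^ 2 ≤ Real.exp (1 - (x - 1) ^ 2) := by
    intro y hy
    have := pow_le_pow_left₀ (abs_nonneg y) hy 2
    rw [sq_abs, ← Real.exp_nat_mul] at this
    refine this.trans_eq ?_
    congr 1
    push_cast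
    ring
  have h1 : φ' t ^ 2 ≤ Real.exp (1 - (x - 1) ^ 2) := hsq _ <| by
    have := h.abs_deriv_le hμ hξ ht
    rwa [show t - 1 - ξ = x - 1 by rw [hx]; ring] at this
  have h2 : φ t ^ 2 ≤ Real.exp (1 - (x - 1) ^ 2) := hsq _ <| by
    rw [abs_of_pos (h.pos t (by simp only [mem_Ici]; linarith))]
    refine (h.apply_le hμ hξ (by linarith)).trans (Real.exp_le_exp.2 ?_)
    rw [← hx]
    nlinarith
  have hb : 0 < 1 - ε := by linarith
  have h3 : ε * x ^ 2 + (1 - (x - 1) ^ 2) ≤ 2 / (1 - ε) + -((1 - ε) / 2) * x ^ 2 := by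
    have h4 : 0 ≤ ((1 - ε) * x - 2) ^ 2 / (2 * (1 - ε)) := by positivity
    have h5 : ((1 - ε) * x - 2) ^ 2 / (2 * (1 - ε)) =
        (1 - ε) / 2 * x ^ 2 - 2 * x + 2 / (1 - ε) := by
      field_simp
      ring
    nlinarith
  calc Real.exp (ε * x ^ 2) * (φ' t ^ 2 + φ t ^ 2)
      ≤ Real.exp (ε * x ^ 2) * (2 * Real.exp (1 - (x - 1) ^ 2)) := by
        gcongr
        linarith
    _ = 2 * Real.exp (ε * x ^ 2 + (1 - (x - 1) ^ 2)) := by rw [Real.exp_add]; ring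
    _ ≤ 2 * Real.exp (2 / (1 - ε) + -((1 - ε) / 2) * x ^ 2) := by gcongr
    _ = _ := by rw [Real.exp_add]; ring

end IsGroundState

/-- Uniform Agmon-type exponential decay of the ground state `φ_γ` at infinity. -/
theorem groundState_agmon_decay :
    ∀ ε ∈ Ioo (0:ℝ) 1, ∃ C > (0:ℝ), ∀ γ ξs : ℝ, ∀ φ φ' φ'' : ℝ → ℝ,
      mu1 γ ξs = Theta γ → ξs ^ 2 = Theta γ + γ ^ 2 →
      IsGroundState γ ξs (Theta γ) φ φ' φ'' →
      (∫ t in {t : ℝ | 0 ≤ t ∧ C ≤ t - ξs},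
          Real.exp (ε * (t - ξs) ^ 2) * ((φ' t) ^ 2 + (φ t) ^ 2))
        ≤ C ^ 2 * (1 + max (-γ) 0 + (max (-γ) 0) ^ 2) ^ 2 := by
  rintro ε ⟨-, hε⟩
  set G : ℝ → ℝ := fun x =>
    2 * Real.exp (2 / (1 - ε)) * Real.exp (-((1 - ε) / 2) * x ^ 2) with hG
  have hGint : Integrable G := (integrable_exp_neg_mul_sq (by linarith)).const_mul _
  have hGnonneg : ∀ x, 0 ≤ G x := fun x => by positivity
  have hK : 0 ≤ ∫ x, G x := integral_nonneg hGnonneg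
  refine ⟨2 + ∫ x, G x, by linarith, ?_⟩
  set C := 2 + ∫ x, G x with hC
  intro γ ξ φ φ' φ'' _ hξ h
  have hμ := h.energy_le_one hξ
  have hξ0 := (h.center_pos hξ).le
  have hmeas : MeasurableSet {t : ℝ | 0 ≤ t ∧ C ≤ t - ξ} :=
    (measurableSet_le measurable_const measurable_id).inter
      (measurableSet_le measurable_const (measurable_id.sub_const ξ))
  have hGt : Integrable (fun t => G (t - ξ)) := hGint.comp_sub_right ξ
  have hγ : 1 ≤ (1 + max (-γ) 0 + (max (-γ) 0) ^ 2) ^ 2 :=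
    one_le_pow₀ (by nlinarith [le_max_right (-γ) 0])
  calc (∫ t in {t : ℝ | 0 ≤ t ∧ C ≤ t - ξ},
          Real.exp (ε * (t - ξ) ^ 2) * ((φ' t) ^ 2 + (φ t) ^ 2))
      ≤ ∫ t in {t : ℝ | 0 ≤ t ∧ C ≤ t - ξ}, G (t - ξ) := by
        refine integral_mono_of_nonneg (ae_of_all _ fun t => by positivity)
          hGt.integrableOn ((ae_restrict_iff' hmeas).2 (ae_of_all _ fun t ht => ?_))
        exact h.weighted_density_le hμ hξ0 hε (by linarith [ht.2])
    _ ≤ ∫ t, G (t - ξ) := setIntegral_le_integral hGt (ae_of_all _ fun t => hGnonneg _)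
    _ = ∫ x, G x := integral_sub_right_eq_self G ξ
    _ ≤ C ^ 2 := by nlinarith
    _ ≤ C ^ 2 * (1 + max (-γ) 0 + (max (-γ) 0) ^ 2) ^ 2 :=
        le_mul_of_one_le_right (sq_nonneg C) hγ
end

section
/- For every γ ∈ ℝ, the infimum, over all admissible half-plane functions u not identically zero, of the quotient [∫_{ℝ×(0,∞)} |(∇ − iA₀)u(x)|² dx + γ·∫_ℝ |u(x₁,0)|² dx₁] / ∫_{ℝ×(0,∞)} |u(x)|² dx equals Θ(γ) = inf over ξ ∈ ℝ of μ⁽¹⁾(γ,ξ). -/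
open MeasureTheory Set Filter

section

open scoped FourierTransform ENNReal ContDiff SchwartzMap Topology

/-- The `L²` Fourier transform agrees almost everywhere with the integral one on `L¹ ∩ L²`. -/
theorem fourier_toLp_ae_eq {f : ℝ → ℂ} (hf : Integrable f) (hf2 : MemLp f 2) :
    ((𝓕 (hf2.toLp f) : Lp ℂ 2 (volume : Measure ℝ)) : ℝ → ℂ) =ᵐ[volume] 𝓕 f := by
  refine ae_eq_of_integral_contDiff_smul_eq
    ((Lp.memLp _).locallyIntegrable (by norm_num)) ?_ ?_
  · have : Continuous (𝓕 f) :=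
      VectorFourier.fourierIntegral_continuous Real.continuous_fourierChar
        (by exact continuous_inner) hf
    exact this.locallyIntegrable
  intro g hg hgc
  have hg' : ContDiff ℝ ∞ (fun x => (g x : ℂ)) := Complex.ofRealCLM.contDiff.comp hg
  have hgc' : HasCompactSupport (fun x => (g x : ℂ)) :=
    hgc.comp_left (g := fun x : ℝ => (x : ℂ)) (by simp)
  let G : 𝓢(ℝ, ℂ) := hgc'.toSchwartzMap hg'
  have hG : ∀ x, G x = (g x : ℂ) := fun x => rfl
  have key := congrArg (fun T => T G) (Lp.fourier_toTemperedDistribution_eq (hf2.toLp f))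
  simp only [TemperedDistribution.fourier_apply, Lp.toTemperedDistribution_apply] at key
  have e1 : ∫ x, g x • ((𝓕 (hf2.toLp f) : Lp ℂ 2 (volume : Measure ℝ)) : ℝ → ℂ) x
      = ∫ x, G x • ((𝓕 (hf2.toLp f) : Lp ℂ 2 (volume : Measure ℝ)) : ℝ → ℂ) x := by
    simp [hG]
  rw [e1, ← key]
  have e2 : ∫ x, (𝓕 G) x • (hf2.toLp f : ℝ → ℂ) x = ∫ x, (𝓕 (G : ℝ → ℂ)) x • f x := by
    apply integral_congr_ae
    filter_upwards [hf2.coeFn_toLp] with x hx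
    rw [hx, SchwartzMap.fourier_coe]
  rw [e2]
  have := VectorFourier.integral_fourierIntegral_smul_eq_flip (μ := volume) (ν := volume)
    (L := innerₗ ℝ) (f := (G : ℝ → ℂ)) (g := f)
    Real.continuous_fourierChar (by exact continuous_inner) G.integrable hf
  rw [flip_innerₗ] at this
  refine Eq.trans this ?_
  simp only [hG]
  rfl

/-- Plancherel's theorem on `L¹ ∩ L²`. -/
theorem integral_norm_sq_fourier_eq {f : ℝ → ℂ} (hf : Integrable f) (hf2 : MemLp f 2) :
    Integrable (fun k => ‖𝓕 f k‖ ^ 2) ∧ ∫ k, ‖𝓕 f k‖ ^ 2 = ∫ x, ‖f x‖ ^ 2 := by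
  have h := fourier_toLp_ae_eq hf hf2
  have hm : MemLp (𝓕 f) 2 := (memLp_congr_ae h).1 (Lp.memLp _)
  refine ⟨hm.integrable_norm_pow (by norm_num), ?_⟩
  have n := Lp.norm_fourier_eq (hf2.toLp f)
  have e : (𝓕 (hf2.toLp f) : Lp ℂ 2 (volume : Measure ℝ)) = hm.toLp _ := by
    rw [Lp.ext_iff]; exact h.trans hm.coeFn_toLp.symm
  rw [e, Lp.norm_toLp, Lp.norm_toLp,
    ENNReal.toReal_eq_toReal_iff' hm.2.ne hf2.2.ne] at n
  rw [hm.eLpNorm_eq_integral_rpow_norm (by norm_num) (by norm_num),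
    hf2.eLpNorm_eq_integral_rpow_norm (by norm_num) (by norm_num),
    ENNReal.ofReal_eq_ofReal_iff (by positivity) (by positivity)] at n
  have := (Real.rpow_left_inj (by positivity) (by positivity) (by norm_num)).1 n
  simpa using this

/-- Cauchy–Schwarz against the constant function on a finite measure space. -/
theorem norm_integral_sq_le {α : Type*} [MeasurableSpace α] {μ : Measure α} [IsFiniteMeasure μ]
    {g : α → ℂ} (hg : Integrable g μ) (hg2 : Integrable (fun x => ‖g x‖ ^ 2) μ) :
    ‖∫ x, g x ∂μ‖ ^ 2 ≤ μ.real univ * ∫ x, ‖g x‖ ^ 2 ∂μ := by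
  have h1 : ‖∫ x, g x ∂μ‖ ≤ ∫ x, ‖g x‖ ∂μ := norm_integral_le_integral_norm _
  have h0 : ∀ c : ℝ, 0 ≤ (∫ x, ‖g x‖ ^ 2 ∂μ) - 2 * c * (∫ x, ‖g x‖ ∂μ) + c ^ 2 * μ.real univ := by
    intro c
    have : (∫ x, ‖g x‖ ^ 2 ∂μ) - 2 * c * (∫ x, ‖g x‖ ∂μ) + c ^ 2 * μ.real univ
        = ∫ x, (‖g x‖ - c) ^ 2 ∂μ := by
      have : ∀ x, (‖g x‖ - c) ^ 2 = ‖g x‖ ^ 2 - 2 * c * ‖g x‖ + c ^ 2 := fun x => by ring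
      simp_rw [this]
      rw [integral_add (by exact hg2.sub (hg.norm.const_mul _)) (integrable_const _),
        integral_sub hg2 (hg.norm.const_mul _), integral_const_mul, integral_const]
      simp [mul_comm]
    rw [this]
    exact integral_nonneg fun x => sq_nonneg _
  have h2 : (∫ x, ‖g x‖ ∂μ) ^ 2 ≤ μ.real univ * ∫ x, ‖g x‖ ^ 2 ∂μ := by
    rcases (measureReal_nonneg (μ := μ) (s := univ)).eq_or_lt with h | h
    · have hμ : μ = 0 := by
        rw [eq_comm, measureReal_eq_zero_iff] at h
        exact Measure.measure_univ_eq_zero.1 h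
      simp [hμ]
    · have := h0 ((∫ x, ‖g x‖ ∂μ) / μ.real univ)
      have e : (∫ x, ‖g x‖ ^ 2 ∂μ) - 2 * ((∫ x, ‖g x‖ ∂μ) / μ.real univ) * (∫ x, ‖g x‖ ∂μ)
          + ((∫ x, ‖g x‖ ∂μ) / μ.real univ) ^ 2 * μ.real univ
          = (∫ x, ‖g x‖ ^ 2 ∂μ) - (∫ x, ‖g x‖ ∂μ) ^ 2 / μ.real univ := by
        field_simp; ring
      rw [e, sub_nonneg, div_le_iff₀ h] at this
      linarith
  exact (pow_le_pow_left₀ (norm_nonneg _) h1 2).trans h2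

/-- Cauchy–Schwarz on an initial segment of the half-line. -/
theorem norm_intervalIntegral_sq_le {g : ℝ → ℂ} {t a : ℝ} (ht : 0 ≤ t) (hta : t ≤ a)
    (hg : IntervalIntegrable g volume 0 t) (hg2 : IntegrableOn (fun s => ‖g s‖ ^ 2) (Ioi 0)) :
    ‖∫ s in (0:ℝ)..t, g s‖ ^ 2 ≤ a * ∫ s in Ioi (0:ℝ), ‖g s‖ ^ 2 := by
  rw [intervalIntegral.integral_of_le ht]
  have h := norm_integral_sq_le ((intervalIntegrable_iff_integrableOn_Ioc_of_le ht).1 hg)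
    (hg2.mono_set Ioc_subset_Ioi_self)
  have hm : (volume.restrict (Ioc 0 t)).real univ = t := by
    simp [measureReal_def, ht]
  rw [hm] at h
  refine h.trans ?_
  have h3 : ∫ s in Ioc 0 t, ‖g s‖ ^ 2 ≤ ∫ s in Ioi (0:ℝ), ‖g s‖ ^ 2 :=
    setIntegral_mono_set hg2 (ae_of_all _ fun x => by positivity)
      (LE.le.eventuallyLE Ioc_subset_Ioi_self)
  have h4 : 0 ≤ ∫ s in Ioc 0 t, ‖g s‖ ^ 2 := integral_nonneg fun x => by positivity
  have h5 : 0 ≤ ∫ s in Ioi (0:ℝ), ‖g s‖ ^ 2 := integral_nonneg fun x => by positivity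
  nlinarith

theorem HasCompactSupport.norm_sq {α : Type*} [TopologicalSpace α] {f : α → ℂ}
    (hf : HasCompactSupport f) : HasCompactSupport (fun x => ‖f x‖ ^ 2) := by
  simp only [sq]
  exact hf.norm.mul_left

namespace AdmissibleHL

variable {f f' : ℝ → ℂ}

/-- Trace inequality on the half-line. -/
theorem norm_sq_zero_le (h : AdmissibleHL f f') {a : ℝ} (ha : 0 < a) :
    ‖f 0‖ ^ 2 ≤ 2 / a * (∫ t in Ioi (0:ℝ), ‖f t‖ ^ 2)
      + 2 * a * ∫ t in Ioi (0:ℝ), ‖f' t‖ ^ 2 := by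
  set D := ∫ t in Ioi (0:ℝ), ‖f' t‖ ^ 2
  have hp : ∀ t ∈ Ioc 0 a, ‖f 0‖ ^ 2 ≤ 2 * ‖f t‖ ^ 2 + 2 * (a * D) := by
    intro t ht
    have h1 := norm_intervalIntegral_sq_le ht.1.le ht.2 (h.locInt t ht.1.le) h.memL2'
    have h2 : ‖f 0‖ ≤ ‖f t‖ + ‖∫ s in (0:ℝ)..t, f' s‖ := by
      have : f 0 = f t - ∫ s in (0:ℝ)..t, f' s := by rw [h.ac t ht.1.le]; ring
      rw [this]; exact norm_sub_le _ _
    have h3 : ‖f 0‖ ^ 2 ≤ (‖f t‖ + ‖∫ s in (0:ℝ)..t, f' s‖) ^ 2 :=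
      pow_le_pow_left₀ (norm_nonneg _) h2 2
    nlinarith [sq_nonneg (‖f t‖ - ‖∫ s in (0:ℝ)..t, f' s‖)]
  have hfa := h.memL2.mono_set (show Ioc 0 a ⊆ Ioi 0 from Ioc_subset_Ioi_self)
  have hi : ∫ t in Ioc 0 a, ‖f 0‖ ^ 2 ≤ ∫ t in Ioc 0 a, (2 * ‖f t‖ ^ 2 + 2 * (a * D)) :=
    setIntegral_mono_on (integrable_const _) ((hfa.const_mul 2).add (integrable_const _))
      measurableSet_Ioc hp
  rw [integral_add (hfa.const_mul 2) (integrable_const _), integral_const_mul] at hi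
  simp only [integral_const, MeasurableSet.univ, measureReal_restrict_apply, univ_inter,
    Real.volume_real_Ioc_of_le ha.le, sub_zero, smul_eq_mul] at hi
  have h3 : ∫ s in Ioc 0 a, ‖f s‖ ^ 2 ≤ ∫ s in Ioi (0:ℝ), ‖f s‖ ^ 2 :=
    setIntegral_mono_set h.memL2 (ae_of_all _ fun x => by positivity)
      (LE.le.eventuallyLE Ioc_subset_Ioi_self)
  have h4 : a * ‖f 0‖ ^ 2 ≤ 2 * (∫ s in Ioi (0:ℝ), ‖f s‖ ^ 2) + 2 * a ^ 2 * D := by nlinarith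
  have e : 2 / a * (∫ s in Ioi (0:ℝ), ‖f s‖ ^ 2) + 2 * a * D
      = (2 * (∫ s in Ioi (0:ℝ), ‖f s‖ ^ 2) + 2 * a ^ 2 * D) / a := by field_simp
  rw [e, le_div_iff₀ ha]
  linarith

theorem integral_pos (h : AdmissibleHL f f') (hne : ∃ t ∈ Ici (0:ℝ), f t ≠ 0) :
    0 < ∫ t in Ioi (0:ℝ), ‖f t‖ ^ 2 := by
  by_contra hcon
  have hz : ∫ t in Ioi (0:ℝ), ‖f t‖ ^ 2 = 0 :=
    le_antisymm (not_lt.1 hcon) (integral_nonneg fun x => by positivity)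
  rw [← integral_Ici_eq_integral_Ioi] at hz
  have hz2 := (setIntegral_eq_zero_iff_of_nonneg_ae
    (ae_of_all _ fun x => by positivity) ((integrableOn_Ici_iff_integrableOn_Ioi (by simp)).2 h.memL2)).1 hz
  have := Measure.eqOn_of_ae_eq hz2 (h.cont.norm.pow 2) continuousOn_const
    (by rw [interior_Ici, closure_Ioi])
  obtain ⟨t, ht, hft⟩ := hne
  have := this ht
  simp [hft] at this

theorem integrable_potential (h : AdmissibleHL f f') (ξ : ℝ) :
    IntegrableOn (fun t => (t - ξ) ^ 2 * ‖f t‖ ^ 2) (Ioi 0) := by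
  refine Integrable.mono' (g := fun t => 2 * (t ^ 2 * ‖f t‖ ^ 2) + 2 * ξ ^ 2 * ‖f t‖ ^ 2)
    ((h.memL2t.const_mul 2).add (h.memL2.const_mul _)) ?_ ?_
  · refine ContinuousOn.aestronglyMeasurable (s := Ioi 0) ?_ measurableSet_Ioi
    exact ContinuousOn.mul (by fun_prop) ((h.cont.mono Ioi_subset_Ici_self).norm.pow 2)
  · refine ae_of_all _ fun t => ?_
    rw [Real.norm_of_nonneg (by positivity)]
    nlinarith [sq_nonneg (t + ξ), mul_nonneg (sq_nonneg (t + ξ)) (sq_nonneg ‖f t‖)]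

theorem qform_eq (h : AdmissibleHL f f') (γ ξ : ℝ) :
    qform γ ξ f f' = (∫ t in Ioi (0:ℝ), ‖f' t‖ ^ 2)
      + (∫ t in Ioi (0:ℝ), (t - ξ) ^ 2 * ‖f t‖ ^ 2) + γ * ‖f 0‖ ^ 2 := by
  rw [qform, integral_add h.memL2' (h.integrable_potential ξ)]

/-- The forms `q[γ,ξ]` are bounded below uniformly in `ξ`. -/
theorem le_qform (h : AdmissibleHL f f') (γ ξ : ℝ) :
    -(4 * |γ| * (|γ| + 1)) * (∫ t in Ioi (0:ℝ), ‖f t‖ ^ 2) ≤ qform γ ξ f f' := by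
  rw [h.qform_eq]
  have hγ := abs_nonneg γ
  have ha : 0 < 1 / (2 * (|γ| + 1)) := by positivity
  have h1 := h.norm_sq_zero_le ha
  have hD : 0 ≤ ∫ t in Ioi (0:ℝ), ‖f' t‖ ^ 2 := integral_nonneg fun x => by positivity
  have hP : 0 ≤ ∫ t in Ioi (0:ℝ), (t - ξ) ^ 2 * ‖f t‖ ^ 2 := integral_nonneg fun x => by positivity
  have e1 : 2 / (1 / (2 * (|γ| + 1))) = 4 * (|γ| + 1) := by field_simp; ring
  have e2 : |γ| * (2 * (1 / (2 * (|γ| + 1)))) ≤ 1 := by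
    have : |γ| * (2 * (1 / (2 * (|γ| + 1)))) = |γ| / (|γ| + 1) := by field_simp
    rw [this, div_le_one (by positivity)]; linarith
  rw [e1] at h1
  have h2 : -(|γ| * ‖f 0‖ ^ 2) ≤ γ * ‖f 0‖ ^ 2 := by
    nlinarith [neg_abs_le γ, sq_nonneg ‖f 0‖]
  have h3 := mul_le_mul_of_nonneg_left h1 hγ
  have h4 := mul_le_mul_of_nonneg_right e2 hD
  nlinarith

/-- A continuous, compactly supported function with continuous, compactly supported
derivative on the half-line is admissible. -/
theorem of_continuous (hf : Continuous f) (hf' : Continuous f') (hs : HasCompactSupport f)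
    (hs' : HasCompactSupport f') (hac : ∀ t ∈ Ici (0:ℝ), f t = f 0 + ∫ s in (0:ℝ)..t, f' s) :
    AdmissibleHL f f' where
  cont := hf.continuousOn
  locInt t _ := hf'.intervalIntegrable _ _
  ac := hac
  memL2 := by
    refine (Continuous.integrable_of_hasCompactSupport (hf.norm.pow 2) ?_).integrableOn
    exact hs.norm_sq
  memL2' := by
    refine (Continuous.integrable_of_hasCompactSupport (hf'.norm.pow 2) ?_).integrableOn
    exact hs'.norm_sq
  memL2t := by
    refine (Continuous.integrable_of_hasCompactSupport
      ((continuous_id.pow 2).mul (hf.norm.pow 2)) ?_).integrableOn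
    exact hs.norm_sq.mul_left

theorem of_contDiff (hf : ContDiff ℝ 1 f) (hs : HasCompactSupport f) :
    AdmissibleHL f (deriv f) :=
  of_continuous hf.continuous (hf.continuous_deriv le_rfl) hs hs.deriv fun t _ => by
    rw [intervalIntegral.integral_deriv_eq_sub (fun x _ => (hf.differentiable (by norm_num)) x)
      ((hf.continuous_deriv le_rfl).intervalIntegrable _ _)]
    ring

end AdmissibleHL

/-- A smooth compactly supported function that does not vanish at the origin. -/
theorem exists_contDiff_hasCompactSupport :
    ∃ f : ℝ → ℂ, ContDiff ℝ 1 f ∧ HasCompactSupport f ∧ f 0 ≠ 0 := by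
  let b : ContDiffBump (0:ℝ) := ⟨1, 2, by norm_num, by norm_num⟩
  refine ⟨fun x => (b x : ℂ), Complex.ofRealCLM.contDiff.comp b.contDiff,
    b.hasCompactSupport.comp_left (g := fun x : ℝ => (x : ℂ)) (by simp), ?_⟩
  simp [b.one_of_mem_closedBall (x := 0) (by simp [b])]

theorem mu1_set_nonempty (γ ξ : ℝ) :
    { r : ℝ | ∃ u u' : ℝ → ℂ, AdmissibleHL u u' ∧ (∃ t ∈ Ici (0:ℝ), u t ≠ 0) ∧
      r = qform γ ξ u u' / ∫ t in Ioi (0:ℝ), ‖u t‖ ^ 2 }.Nonempty := by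
  obtain ⟨f, hf, hs, h0⟩ := exists_contDiff_hasCompactSupport
  exact ⟨_, f, deriv f, .of_contDiff hf hs, ⟨0, self_mem_Ici, h0⟩, rfl⟩

theorem mu1_set_lowerBound (γ ξ : ℝ) :
    -(4 * |γ| * (|γ| + 1)) ∈ lowerBounds
    { r : ℝ | ∃ u u' : ℝ → ℂ, AdmissibleHL u u' ∧ (∃ t ∈ Ici (0:ℝ), u t ≠ 0) ∧
      r = qform γ ξ u u' / ∫ t in Ioi (0:ℝ), ‖u t‖ ^ 2 } := by
  rintro r ⟨u, u', h, hne, rfl⟩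
  rw [le_div_iff₀ (h.integral_pos hne)]
  exact h.le_qform γ ξ

/-- `Θ(γ)` bounds every form `q[γ,ξ]` from below. -/
theorem AdmissibleHL.Theta_mul_le {f f' : ℝ → ℂ} (h : AdmissibleHL f f') (γ ξ : ℝ) :
    Theta γ * (∫ t in Ioi (0:ℝ), ‖f t‖ ^ 2) ≤ qform γ ξ f f' := by
  by_cases hne : ∃ t ∈ Ici (0:ℝ), f t ≠ 0
  · rw [← le_div_iff₀ (h.integral_pos hne)]
    have h1 : Theta γ ≤ mu1 γ ξ := by
      refine ciInf_le ⟨-(4 * |γ| * (|γ| + 1)), ?_⟩ ξ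
      rintro _ ⟨ξ, rfl⟩
      exact le_csInf (mu1_set_nonempty γ ξ) (mu1_set_lowerBound γ ξ)
    exact h1.trans (csInf_le ⟨_, mu1_set_lowerBound γ ξ⟩ ⟨f, f', h, hne, rfl⟩)
  · push Not at hne
    have hz : ∫ t in Ioi (0:ℝ), ‖f t‖ ^ 2 = 0 :=
      setIntegral_eq_zero_of_forall_eq_zero fun t ht => by
        rw [hne t (Ioi_subset_Ici_self ht)]; simp
    have := h.le_qform γ ξ
    rw [hz] at this ⊢
    simpa using this

/-- Fourier transform in the first variable. -/
noncomputable def partialFourier (W : ℝ × ℝ → ℂ) (k t : ℝ) : ℂ := 𝓕 (fun x => W (x, t)) k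

section PartialFourier

variable {W : ℝ × ℝ → ℂ}

theorem HasCompactSupport.exists_abs_le (hs : HasCompactSupport W) :
    ∃ R : ℝ, ∀ x t, R < |x| ∨ R < |t| → W (x, t) = 0 := by
  obtain ⟨R, hR⟩ := hs.isCompact.isBounded.exists_norm_le
  refine ⟨R, fun x t h => ?_⟩
  by_contra hne
  have := hR (x, t) (subset_tsupport _ hne)
  rw [Prod.norm_mk, sup_le_iff, Real.norm_eq_abs, Real.norm_eq_abs] at this
  rcases h with h | h <;> linarith

theorem HasCompactSupport.slice_left (hs : HasCompactSupport W) (t : ℝ) :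
    HasCompactSupport (fun x => W (x, t)) := by
  obtain ⟨R, hR⟩ := hs.exists_abs_le
  refine HasCompactSupport.of_support_subset_isCompact (isCompact_Icc (a := -R) (b := R)) ?_
  intro x hx
  by_contra h
  refine hx (hR x t (Or.inl ?_))
  rw [mem_Icc, ← abs_le] at h
  exact not_le.1 h

theorem integrable_slice (hW : Continuous W) (hs : HasCompactSupport W) (t : ℝ) :
    Integrable (fun x => W (x, t)) :=
  Continuous.integrable_of_hasCompactSupport (by fun_prop) (hs.slice_left t)

theorem partialFourier_eq (k t : ℝ) :
    partialFourier W k t = ∫ x : ℝ, Real.fourierChar (-(x * k)) • W (x, t) := by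
  rw [partialFourier, Real.fourier_real_eq]

theorem continuous_partialFourier (hW : Continuous W) (hs : HasCompactSupport W) :
    Continuous (fun p : ℝ × ℝ => partialFourier W p.1 p.2) := by
  obtain ⟨R, hR⟩ := hs.exists_abs_le
  have e : ∀ p : ℝ × ℝ, partialFourier W p.1 p.2
      = ∫ x in Icc (-R) R, Real.fourierChar (-(x * p.1)) • W (x, p.2) := by
    intro p
    rw [partialFourier_eq, setIntegral_eq_integral_of_forall_compl_eq_zero]
    intro x hx
    rw [mem_Icc, ← abs_le, not_le] at hx
    rw [hR x p.2 (Or.inl hx), smul_zero]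
  simp_rw [e]
  refine continuous_parametric_integral_of_continuous
    (f := fun (p : ℝ × ℝ) (x : ℝ) => Real.fourierChar (-(x * p.1)) • W (x, p.2)) ?_ isCompact_Icc
  have : Continuous (Real.fourierChar : ℝ → Circle) := Real.continuous_fourierChar
  simp only [Function.uncurry_def]
  exact (this.comp (by fun_prop)).smul (by fun_prop)

theorem continuous_partialFourier_right (hW : Continuous W) (hs : HasCompactSupport W) (k : ℝ) :
    Continuous (partialFourier W k) := by
  have h : Continuous fun t : ℝ => (k, t) := by fun_prop
  exact (continuous_partialFourier hW hs).comp h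

theorem hasCompactSupport_partialFourier (hs : HasCompactSupport W) (k : ℝ) :
    HasCompactSupport (partialFourier W k) := by
  obtain ⟨R, hR⟩ := hs.exists_abs_le
  refine HasCompactSupport.of_support_subset_isCompact (isCompact_Icc (a := -R) (b := R)) ?_
  intro t ht
  by_contra h
  rw [mem_Icc, ← abs_le, not_le] at h
  refine ht ?_
  rw [partialFourier_eq]
  simp [hR _ t (Or.inr h)]

theorem partialFourier_plancherel (hW : Continuous W) (hs : HasCompactSupport W) (t : ℝ) :
    Integrable (fun k => ‖partialFourier W k t‖ ^ 2) ∧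
      ∫ k, ‖partialFourier W k t‖ ^ 2 = ∫ x, ‖W (x, t)‖ ^ 2 :=
  integral_norm_sq_fourier_eq (integrable_slice hW hs t)
    (Continuous.memLp_of_hasCompactSupport (by fun_prop) (hs.slice_left t))

theorem integrable_norm_sq (hW : Continuous W) (hs : HasCompactSupport W) :
    Integrable (fun p => ‖W p‖ ^ 2) (volume.prod (volume.restrict (Ioi (0:ℝ)))) := by
  have h : Integrable (fun p => ‖W p‖ ^ 2) (volume.prod (volume : Measure ℝ)) :=
    Continuous.integrable_of_hasCompactSupport (by fun_prop) hs.norm_sq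
  have e : (volume.prod (volume.restrict (Ioi (0:ℝ))) : Measure (ℝ × ℝ))
      = (volume.prod volume).restrict (univ ×ˢ Ioi 0) := by
    rw [← Measure.prod_restrict, Measure.restrict_univ]
  rw [e]
  exact h.restrict

theorem integrable_partialFourier_norm_sq (hW : Continuous W) (hs : HasCompactSupport W) :
    Integrable (fun p : ℝ × ℝ => ‖partialFourier W p.1 p.2‖ ^ 2)
      (volume.prod (volume.restrict (Ioi (0:ℝ)))) := by
  rw [integrable_prod_iff']
  · refine ⟨ae_of_all _ fun t => (partialFourier_plancherel hW hs t).1, ?_⟩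
    simp only [norm_pow, norm_norm, (partialFourier_plancherel hW hs _).2]
    exact (integrable_norm_sq hW hs).integral_prod_right
  · exact ((continuous_partialFourier hW hs).norm.pow 2).aestronglyMeasurable

theorem integrable_integral_partialFourier_norm_sq (hW : Continuous W)
    (hs : HasCompactSupport W) :
    Integrable (fun k => ∫ t in Ioi (0:ℝ), ‖partialFourier W k t‖ ^ 2) :=
  (integrable_partialFourier_norm_sq hW hs).integral_prod_left

theorem integral_partialFourier_norm_sq (hW : Continuous W) (hs : HasCompactSupport W) :
    ∫ k, ∫ t in Ioi (0:ℝ), ‖partialFourier W k t‖ ^ 2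
      = ∫ t in Ioi (0:ℝ), ∫ x, ‖W (x, t)‖ ^ 2 := by
  rw [integral_integral_swap (integrable_partialFourier_norm_sq hW hs)]
  simp only [(partialFourier_plancherel hW hs _).2]

theorem integrable_fourierChar_smul_slice (hW : Continuous W) (hs : HasCompactSupport W)
    (k t : ℝ) : Integrable (fun x : ℝ => Real.fourierChar (-(x * k)) • W (x, t)) := by
  have hc : Continuous (Real.fourierChar : ℝ → Circle) := Real.continuous_fourierChar
  exact Continuous.integrable_of_hasCompactSupport ((hc.comp (by fun_prop)).smul (by fun_prop))
    ((hs.slice_left t).smul_left)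

theorem partialFourier_ac {W' : ℝ × ℝ → ℂ} (hW : Continuous W) (hs : HasCompactSupport W)
    (hW' : Continuous W') (hs' : HasCompactSupport W')
    (hac : ∀ x, ∀ t ∈ Ici (0:ℝ), W (x, t) = W (x, 0) + ∫ s in (0:ℝ)..t, W' (x, s))
    (k : ℝ) : ∀ t ∈ Ici (0:ℝ), partialFourier W k t
      = partialFourier W k 0 + ∫ s in (0:ℝ)..t, partialFourier W' k s := by
  intro t ht
  have hc : Continuous (Real.fourierChar : ℝ → Circle) := Real.continuous_fourierChar
  have hi := integrable_fourierChar_smul_slice hW hs k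
  rw [← sub_eq_iff_eq_add']
  simp only [partialFourier_eq]
  rw [← integral_sub (hi t) (hi 0), intervalIntegral_integral_swap]
  · congr 1
    ext x
    rw [← smul_sub, hac x t ht, add_sub_cancel_left]
    simp only [Circle.smul_def]
    rw [intervalIntegral.integral_smul]
  · have h : Integrable (fun p : ℝ × ℝ => Real.fourierChar (-(p.2 * k)) • W' (p.2, p.1))
        (volume.prod volume) :=
      Continuous.integrable_of_hasCompactSupport ((hc.comp (by fun_prop)).smul (by fun_prop))
        ((hs'.comp_homeomorph (Homeomorph.prodComm ℝ ℝ)).smul_left)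
    have e : ((volume.restrict (uIoc 0 t)).prod volume : Measure (ℝ × ℝ))
        = (volume.prod volume).restrict (uIoc 0 t ×ˢ univ) := by
      rw [← Measure.prod_restrict, Measure.restrict_univ]
    rw [e]
    exact h.restrict

theorem partialFourier_magnetic {V V₁ : ℝ × ℝ → ℂ} (hV : Continuous V) (hV₁ : Continuous V₁)
    (hs : HasCompactSupport V) (hs₁ : HasCompactSupport V₁)
    (hd : ∀ x t, HasDerivAt (fun x => V (x, t)) (V₁ (x, t)) x) (k t : ℝ) :
    partialFourier (fun p => V₁ p + Complex.I * p.2 * V p) k t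
      = Complex.I * (2 * Real.pi * k + t : ℝ) * partialFourier V k t := by
  have h1 : deriv (fun x => V (x, t)) = fun x => V₁ (x, t) := funext fun x => (hd x t).deriv
  have h2 := Real.fourier_deriv (integrable_slice hV hs t) (fun x => (hd x t).differentiableAt)
    (by rw [h1]; exact integrable_slice hV₁ hs₁ t)
  have h4 : partialFourier (fun p => V₁ p + Complex.I * p.2 * V p) k t
      = partialFourier V₁ k t + (Complex.I * t) * partialFourier V k t := by
    simp only [partialFourier_eq]
    rw [← integral_const_mul, ← integral_add (integrable_fourierChar_smul_slice hV₁ hs₁ k t)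
      ((integrable_fourierChar_smul_slice hV hs k t).const_mul _)]
    congr 1
    ext x
    simp only [Circle.smul_def, smul_eq_mul]
    ring
  have h5 : partialFourier V₁ k t = (2 * Real.pi * Complex.I * k) • partialFourier V k t := by
    rw [partialFourier, ← h1, h2, partialFourier]
  rw [h4, h5, smul_eq_mul]
  push_cast
  ring

theorem norm_sq_partialFourier_magnetic {V V₁ : ℝ × ℝ → ℂ} (hV : Continuous V)
    (hV₁ : Continuous V₁) (hs : HasCompactSupport V) (hs₁ : HasCompactSupport V₁)
    (hd : ∀ x t, HasDerivAt (fun x => V (x, t)) (V₁ (x, t)) x) (k t : ℝ) :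
    ‖partialFourier (fun p => V₁ p + Complex.I * p.2 * V p) k t‖ ^ 2
      = (t - (-(2 * Real.pi * k))) ^ 2 * ‖partialFourier V k t‖ ^ 2 := by
  rw [partialFourier_magnetic hV hV₁ hs hs₁ hd, norm_mul, norm_mul, Complex.norm_I,
    Complex.norm_real, one_mul, mul_pow, Real.norm_eq_abs, sq_abs]
  ring

end PartialFourier

/-- The lower bound for compactly supported functions in the Landau gauge. -/
theorem Theta_mul_le_of_hasCompactSupport (γ : ℝ) {V V₁ V₂ : ℝ × ℝ → ℂ}
    (hV : Continuous V) (hV₁ : Continuous V₁) (hV₂ : Continuous V₂)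
    (hs : HasCompactSupport V) (hs₁ : HasCompactSupport V₁) (hs₂ : HasCompactSupport V₂)
    (hd : ∀ x t, HasDerivAt (fun x => V (x, t)) (V₁ (x, t)) x)
    (hac : ∀ x, ∀ t ∈ Ici (0:ℝ), V (x, t) = V (x, 0) + ∫ s in (0:ℝ)..t, V₂ (x, s)) :
    Theta γ * (∫ t in Ioi (0:ℝ), ∫ x, ‖V (x, t)‖ ^ 2) ≤
      (∫ t in Ioi (0:ℝ), ∫ x, ‖V₂ (x, t)‖ ^ 2)
      + (∫ t in Ioi (0:ℝ), ∫ x, ‖V₁ (x, t) + Complex.I * t * V (x, t)‖ ^ 2)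
      + γ * ∫ x, ‖V (x, 0)‖ ^ 2 := by
  set U : ℝ × ℝ → ℂ := fun p => V₁ p + Complex.I * p.2 * V p with hU
  have hUc : Continuous U := by fun_prop
  have hUs : HasCompactSupport U := hs₁.add hs.mul_left
  have hadm : ∀ k, AdmissibleHL (partialFourier V k) (partialFourier V₂ k) := fun k =>
    .of_continuous (continuous_partialFourier_right hV hs k)
      (continuous_partialFourier_right hV₂ hs₂ k)
      (hasCompactSupport_partialFourier hs k) (hasCompactSupport_partialFourier hs₂ k)
      (partialFourier_ac hV hs hV₂ hs₂ hac k)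
  have hUF : ∀ k t, ‖partialFourier U k t‖ ^ 2
      = (t - (-(2 * Real.pi * k))) ^ 2 * ‖partialFourier V k t‖ ^ 2 :=
    norm_sq_partialFourier_magnetic hV hV₁ hs hs₁ hd
  have hb := partialFourier_plancherel hV hs 0
  have i0 := integrable_integral_partialFourier_norm_sq hV hs
  have i2 := integrable_integral_partialFourier_norm_sq hV₂ hs₂
  have iU := integrable_integral_partialFourier_norm_sq hUc hUs
  have key : ∫ k, Theta γ * (∫ t in Ioi (0:ℝ), ‖partialFourier V k t‖ ^ 2) ≤
      ∫ k, ((∫ t in Ioi (0:ℝ), ‖partialFourier V₂ k t‖ ^ 2)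
        + (∫ t in Ioi (0:ℝ), ‖partialFourier U k t‖ ^ 2) + γ * ‖partialFourier V k 0‖ ^ 2) := by
    refine integral_mono (i0.const_mul _) ((i2.add iU).add (hb.1.const_mul γ)) fun k => ?_
    have h := (hadm k).Theta_mul_le γ (-(2 * Real.pi * k))
    rw [(hadm k).qform_eq] at h
    simpa only [hUF] using h
  rw [integral_const_mul, integral_add (by exact i2.add iU) (hb.1.const_mul γ), integral_add i2 iU,
    integral_const_mul, integral_partialFourier_norm_sq hV hs,
    integral_partialFourier_norm_sq hV₂ hs₂, integral_partialFourier_norm_sq hUc hUs, hb.2] at key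
  exact key

/-- The density `|(∇ - iA₀)u|²`. -/
noncomputable def magneticDensity (u : ℝ × ℝ → ℂ) (du : ℝ × ℝ → (ℝ × ℝ) →L[ℝ] ℂ)
    (p : ℝ × ℝ) : ℝ :=
  ‖du p (1, 0) + Complex.I * ((p.2 : ℂ) / 2) * u p‖ ^ 2 +
    ‖du p (0, 1) - Complex.I * ((p.1 : ℂ) / 2) * u p‖ ^ 2

/-- The magnetic quadratic form on the half-plane with boundary weight `γ`. -/
noncomputable def magneticForm (γ : ℝ) (u : ℝ × ℝ → ℂ)
    (du : ℝ × ℝ → (ℝ × ℝ) →L[ℝ] ℂ) : ℝ :=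
  (∫ p in {q : ℝ × ℝ | 0 < q.2}, magneticDensity u du p) + γ * ∫ x : ℝ, ‖u (x, 0)‖ ^ 2

/-- Continuous differentiability on the closed half-plane, with derivative `du`. -/
structure IsC1HalfPlane (u : ℝ × ℝ → ℂ) (du : ℝ × ℝ → (ℝ × ℝ) →L[ℝ] ℂ) : Prop where
  cont : ContinuousOn u {q : ℝ × ℝ | 0 ≤ q.2}
  deriv : ∀ p : ℝ × ℝ, 0 ≤ p.2 → HasFDerivWithinAt u (du p) {q : ℝ × ℝ | 0 ≤ q.2} p
  cont_deriv : ContinuousOn du {q : ℝ × ℝ | 0 ≤ q.2}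

theorem halfPlane_eq_prod : {q : ℝ × ℝ | 0 < q.2} = univ ×ˢ Ioi (0:ℝ) := by
  ext; simp

theorem measurableSet_halfPlane : MeasurableSet {q : ℝ × ℝ | 0 < q.2} :=
  measurableSet_lt measurable_const measurable_snd

theorem volume_restrict_halfPlane :
    (volume : Measure (ℝ × ℝ)).restrict {q : ℝ × ℝ | 0 < q.2}
      = volume.prod (volume.restrict (Ioi (0:ℝ))) := by
  rw [halfPlane_eq_prod, Measure.volume_eq_prod, ← Measure.prod_restrict, Measure.restrict_univ]

theorem integral_halfPlane_norm_sq {W : ℝ × ℝ → ℂ} (hW : Continuous W)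
    (hs : HasCompactSupport W) :
    ∫ p in {q : ℝ × ℝ | 0 < q.2}, ‖W p‖ ^ 2 = ∫ t in Ioi (0:ℝ), ∫ x, ‖W (x, t)‖ ^ 2 := by
  rw [volume_restrict_halfPlane, integral_prod_symm _ (integrable_norm_sq hW hs)]

namespace IsC1HalfPlane

variable {u : ℝ × ℝ → ℂ} {du : ℝ × ℝ → (ℝ × ℝ) →L[ℝ] ℂ}

theorem hasDerivAt_fst (h : IsC1HalfPlane u du) (x : ℝ) {t : ℝ} (ht : 0 ≤ t) :
    HasDerivAt (fun x => u (x, t)) (du (x, t) (1, 0)) x := by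
  have h1 : HasDerivWithinAt (fun x : ℝ => (x, t)) ((1:ℝ), (0:ℝ)) univ x :=
    ((hasDerivAt_id x).prodMk (hasDerivAt_const x t)).hasDerivWithinAt
  have := (h.deriv (x, t) ht).comp_hasDerivWithinAt x h1 (fun _ _ => ht)
  exact hasDerivWithinAt_univ.1 this

theorem hasDerivWithinAt_snd (h : IsC1HalfPlane u du) (x : ℝ) {t : ℝ} (ht : 0 ≤ t) :
    HasDerivWithinAt (fun s => u (x, s)) (du (x, t) (0, 1)) (Ici 0) t := by
  have h1 : HasDerivWithinAt (fun s : ℝ => (x, s)) ((0:ℝ), (1:ℝ)) (Ici 0) t :=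
    ((hasDerivAt_const t x).prodMk (hasDerivAt_id t)).hasDerivWithinAt
  exact (h.deriv (x, t) ht).comp_hasDerivWithinAt t h1 (fun _ hs => hs)

theorem continuous_fold (h : IsC1HalfPlane u du) : Continuous fun p : ℝ × ℝ => u (p.1, |p.2|) :=
  h.cont.comp_continuous (by fun_prop) (fun p => abs_nonneg p.2)

theorem continuous_fold_deriv (h : IsC1HalfPlane u du) :
    Continuous fun p : ℝ × ℝ => du (p.1, |p.2|) :=
  h.cont_deriv.comp_continuous (by fun_prop) (fun p => abs_nonneg p.2)

/-- The lower bound for compactly supported functions. -/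
theorem Theta_mul_le_of_compact (h : IsC1HalfPlane u du) (γ : ℝ) {K : Set (ℝ × ℝ)}
    (hK : IsCompact K) (hu : ∀ p ∉ K, u p = 0) (hdu : ∀ p ∉ K, du p = 0) :
    Theta γ * (∫ p in {q : ℝ × ℝ | 0 < q.2}, ‖u p‖ ^ 2) ≤ magneticForm γ u du := by
  set e : ℝ × ℝ → ℂ := fun p => Complex.exp (((-(p.1 * |p.2| / 2) : ℝ) : ℂ) * Complex.I) with he
  have hec : Continuous e := by fun_prop
  have hen : ∀ p, ‖e p‖ = 1 := fun p => Complex.norm_exp_ofReal_mul_I _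
  set F : ℝ × ℝ → ℝ × ℝ := fun p => (p.1, |p.2|) with hF
  set V : ℝ × ℝ → ℂ := fun p => e p * u (F p) with hV
  set V₁ : ℝ × ℝ → ℂ := fun p =>
    e p * (du (F p) (1, 0) - Complex.I * ((|p.2| : ℝ) / 2) * u (F p)) with hV₁
  set V₂ : ℝ × ℝ → ℂ := fun p =>
    e p * (du (F p) (0, 1) - Complex.I * ((p.1 : ℝ) / 2) * u (F p)) with hV₂
  have hfu := h.continuous_fold
  have hfd := h.continuous_fold_deriv
  have hfd1 : ∀ v, Continuous fun p => du (F p) v := fun v => hfd.clm_apply continuous_const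
  have hVc : Continuous V := hec.mul hfu
  have hV₁c : Continuous V₁ := hec.mul ((hfd1 _).sub
    (Continuous.mul (by fun_prop) hfu))
  have hV₂c : Continuous V₂ := hec.mul ((hfd1 _).sub
    (Continuous.mul (by fun_prop) hfu))
  obtain ⟨R, hR⟩ := hK.isBounded.exists_norm_le
  have hout : ∀ p, p ∉ Metric.closedBall (0 : ℝ × ℝ) R → F p ∉ K := by
    intro p hp hpK
    apply hp
    have := hR _ hpK
    simpa [hF, Prod.norm_def] using this
  have hVs : HasCompactSupport V := .intro (isCompact_closedBall 0 R) fun p hp => by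
    simp [hV, hu _ (hout p hp)]
  have hV₁s : HasCompactSupport V₁ := .intro (isCompact_closedBall 0 R) fun p hp => by
    simp [hV₁, hu _ (hout p hp), hdu _ (hout p hp)]
  have hV₂s : HasCompactSupport V₂ := .intro (isCompact_closedBall 0 R) fun p hp => by
    simp [hV₂, hu _ (hout p hp), hdu _ (hout p hp)]
  have hd : ∀ x t, HasDerivAt (fun x => V (x, t)) (V₁ (x, t)) x := by
    intro x t
    have h1 := h.hasDerivAt_fst x (abs_nonneg t)
    have h2 : HasDerivAt (fun x => e (x, t)) (e (x, t) * (((-(1 * |t| / 2) : ℝ) : ℂ) * Complex.I)) x := by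
      have h3 : HasDerivAt (fun x : ℝ => -(x * |t| / 2)) (-(1 * |t| / 2)) x :=
        (((hasDerivAt_id x).mul_const _).div_const 2).neg
      exact (h3.ofReal_comp.mul_const Complex.I).cexp
    convert! h2.mul h1 using 1
    simp only [hV₁, hF]
    push_cast
    ring
  have hac : ∀ x, ∀ t ∈ Ici (0:ℝ), V (x, t) = V (x, 0) + ∫ s in (0:ℝ)..t, V₂ (x, s) := by
    intro x t ht
    have hVc' : Continuous fun s => V (x, s) := by fun_prop
    have hV₂c' : Continuous fun s => V₂ (x, s) := by fun_prop
    rw [intervalIntegral.integral_eq_sub_of_hasDeriv_right_of_le (f := fun s => V (x, s)) ht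
      hVc'.continuousOn ?_ (hV₂c'.intervalIntegrable _ _)]
    · ring
    intro s hs
    have h1 := h.hasDerivWithinAt_snd x hs.1.le
    have h2 : HasDerivAt (fun s : ℝ => Complex.exp (((-(x * s / 2) : ℝ) : ℂ) * Complex.I))
        (Complex.exp (((-(x * s / 2) : ℝ) : ℂ) * Complex.I) *
          (((-(x * 1 / 2) : ℝ) : ℂ) * Complex.I)) s := by
      have h3 : HasDerivAt (fun s : ℝ => -(x * s / 2)) (-(x * 1 / 2)) s :=
        (((hasDerivAt_id s).const_mul _).div_const 2).neg
      exact (h3.ofReal_comp.mul_const Complex.I).cexp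
    have h3 := (h2.hasDerivWithinAt (s := Ici 0)).mul h1
    have h4 := h3.congr_of_mem (f₁ := fun s => V (x, s))
      (fun y hy => by simp [hV, he, hF, abs_of_nonneg (mem_Ici.1 hy)]) hs.1.le
    refine (h4.mono (fun y hy => hs.1.le.trans (mem_Ioi.1 hy).le)).congr_deriv ?_
    simp only [hV₂, he, hF, abs_of_pos hs.1]
    push_cast
    ring
  have main := Theta_mul_le_of_hasCompactSupport γ hVc hV₁c hV₂c hVs hV₁s hV₂s hd hac
  set U : ℝ × ℝ → ℂ := fun p => V₁ p + Complex.I * p.2 * V p with hU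
  have hUc : Continuous U := by fun_prop
  have hUs : HasCompactSupport U := hV₁s.add hVs.mul_left
  have e0 : ∫ p in {q : ℝ × ℝ | 0 < q.2}, ‖u p‖ ^ 2 = ∫ p in {q : ℝ × ℝ | 0 < q.2}, ‖V p‖ ^ 2 := by
    refine setIntegral_congr_fun measurableSet_halfPlane fun p hp => ?_
    simp [hV, hF, hen, abs_of_pos (show 0 < p.2 from hp)]
  have e1 : ∫ p in {q : ℝ × ℝ | 0 < q.2}, magneticDensity u du p
      = (∫ p in {q : ℝ × ℝ | 0 < q.2}, ‖V₂ p‖ ^ 2) + ∫ p in {q : ℝ × ℝ | 0 < q.2}, ‖U p‖ ^ 2 := by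
    rw [← integral_add (by rw [volume_restrict_halfPlane]; exact integrable_norm_sq hV₂c hV₂s)
      (by rw [volume_restrict_halfPlane]; exact integrable_norm_sq hUc hUs)]
    refine setIntegral_congr_fun measurableSet_halfPlane fun p hp => ?_
    have hp' : |p.2| = p.2 := abs_of_pos hp
    have hU' : U p = e p * (du p (1, 0) + Complex.I * ((p.2 : ℂ) / 2) * u p) := by
      simp only [hU, hV₁, hV, hF, hp']; ring
    have hV₂' : V₂ p = e p * (du p (0, 1) - Complex.I * ((p.1 : ℂ) / 2) * u p) := by
      simp only [hV₂, hF, hp']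
    simp only [magneticDensity, hU', hV₂', norm_mul, hen, one_mul]
    ring
  have e2 : ∀ x, ‖u (x, 0)‖ ^ 2 = ‖V (x, 0)‖ ^ 2 := fun x => by simp [hV, hF, hen]
  rw [magneticForm, e0, e1, integral_halfPlane_norm_sq hVc hVs,
    integral_halfPlane_norm_sq hV₂c hV₂s, integral_halfPlane_norm_sq hUc hUs]
  simp only [e2]
  exact main

end IsC1HalfPlane

/-- A sequence of cutoff functions tending to one with gradients tending to zero. -/
theorem exists_cutoff (E : Type*) [NormedAddCommGroup E] [NormedSpace ℝ E]
    [FiniteDimensional ℝ E] :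
    ∃ (η : ℕ → E → ℝ) (C : ℝ), (∀ n, ContDiff ℝ 1 (η n)) ∧ (∀ n, HasCompactSupport (η n)) ∧
      (∀ n p, |η n p| ≤ 1) ∧ (∀ n p, ‖fderiv ℝ (η n) p‖ ≤ C) ∧
      (∀ p, Tendsto (fun n => η n p) atTop (𝓝 1)) ∧
      (∀ p, Tendsto (fun n => fderiv ℝ (η n) p) atTop (𝓝 0)) := by
  let b : ContDiffBump (0:E) := ⟨1, 2, by norm_num, by norm_num⟩
  have hb : ContDiff ℝ 1 b := b.contDiff
  obtain ⟨C, hC⟩ := (b.hasCompactSupport.fderiv (𝕜 := ℝ)).exists_bound_of_continuous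
    (hb.continuous_fderiv one_ne_zero)
  have hC0 : 0 ≤ C := (norm_nonneg _).trans (hC 0)
  let c : ℕ → ℝ := fun n => ((n:ℝ) + 1)⁻¹
  have hc0 : ∀ n, 0 < c n := fun n => by positivity
  have hc1 : ∀ n, c n ≤ 1 := fun n => inv_le_one_of_one_le₀ (by simp)
  have hct : Tendsto c atTop (𝓝 0) :=
    (tendsto_one_div_add_atTop_nhds_zero_nat (𝕜 := ℝ)).congr fun n => by simp [c]
  have hfd : ∀ n p, ‖fderiv ℝ (fun p => b (c n • p)) p‖ ≤ c n * C := by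
    intro n p
    rw [fderiv_comp_smul, norm_smul, Real.norm_of_nonneg (hc0 n).le]
    exact mul_le_mul_of_nonneg_left (hC _) (hc0 n).le
  refine ⟨fun n p => b (c n • p), C, fun n => hb.comp (contDiff_const_smul (c n)),
    fun n => b.hasCompactSupport.comp_smul (hc0 n).ne', fun n p => ?_, fun n p => ?_,
    fun p => ?_, fun p => ?_⟩
  · rw [abs_of_nonneg b.nonneg]; exact b.le_one
  · exact (hfd n p).trans (mul_le_of_le_one_left hC0 (hc1 n))
  · have h1 : Tendsto (fun n => c n • p) atTop (𝓝 0) := by simpa using hct.smul_const p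
    have h2 := (b.continuous.tendsto 0).comp h1
    rwa [b.one_of_mem_closedBall (x := 0) (by simp [b])] at h2
  · refine squeeze_zero_norm (fun n => hfd n p) ?_
    simpa using hct.mul_const C

theorem halfPlane_subset : {q : ℝ × ℝ | 0 < q.2} ⊆ {q : ℝ × ℝ | 0 ≤ q.2} :=
  fun q (hq : 0 < q.2) => show 0 ≤ q.2 from hq.le

namespace IsC1HalfPlane

variable {u : ℝ × ℝ → ℂ} {du : ℝ × ℝ → (ℝ × ℝ) →L[ℝ] ℂ}

theorem smul (h : IsC1HalfPlane u du) {η : ℝ × ℝ → ℝ} (hη : ContDiff ℝ 1 η) :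
    IsC1HalfPlane (fun p => η p • u p)
      (fun p => η p • du p + (fderiv ℝ η p).smulRight (u p)) where
  cont := hη.continuous.continuousOn.smul h.cont
  deriv p hp :=
    ((hη.differentiable one_ne_zero p).hasFDerivAt.hasFDerivWithinAt).smul (h.deriv p hp)
  cont_deriv := by
    refine (hη.continuous.continuousOn.smul h.cont_deriv).add ?_
    exact ((ContinuousLinearMap.smulRightL ℝ (ℝ × ℝ) ℂ).continuous.comp
      (hη.continuous_fderiv one_ne_zero)).continuousOn.clm_apply h.cont

theorem continuousOn_magneticDensity (h : IsC1HalfPlane u du) :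
    ContinuousOn (magneticDensity u du) {q : ℝ × ℝ | 0 ≤ q.2} := by
  have h1 : ∀ v, ContinuousOn (fun p => du p v) {q : ℝ × ℝ | 0 ≤ q.2} := fun v =>
    h.cont_deriv.clm_apply continuousOn_const
  exact (((h1 _).add (ContinuousOn.mul (by fun_prop) h.cont)).norm.pow 2).add
    (((h1 _).sub (ContinuousOn.mul (by fun_prop) h.cont)).norm.pow 2)

theorem aestronglyMeasurable {f : ℝ × ℝ → ℝ} (hf : ContinuousOn f {q : ℝ × ℝ | 0 ≤ q.2}) :
    AEStronglyMeasurable f (volume.restrict {q : ℝ × ℝ | 0 < q.2}) :=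
  (hf.mono halfPlane_subset).aestronglyMeasurable measurableSet_halfPlane

theorem magneticDensity_smul_eq (η : ℝ × ℝ → ℝ) (p : ℝ × ℝ) :
    magneticDensity (fun p => η p • u p)
      (fun p => η p • du p + (fderiv ℝ η p).smulRight (u p)) p
    = ‖η p • (du p (1, 0) + Complex.I * ((p.2 : ℂ) / 2) * u p) + fderiv ℝ η p (1, 0) • u p‖ ^ 2
      + ‖η p • (du p (0, 1) - Complex.I * ((p.1 : ℂ) / 2) * u p)
        + fderiv ℝ η p (0, 1) • u p‖ ^ 2 := by
  simp only [magneticDensity, add_apply, smul_apply,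
    ContinuousLinearMap.smulRight_apply, Complex.real_smul]
  congr 3 <;> ring

theorem norm_smul_add_smul_sq_le {a b C : ℝ} (ha : |a| ≤ 1) (hb : |b| ≤ C) (z w : ℂ) :
    ‖a • z + b • w‖ ^ 2 ≤ 2 * ‖z‖ ^ 2 + 2 * C ^ 2 * ‖w‖ ^ 2 := by
  have h1 : ‖a • z + b • w‖ ≤ ‖z‖ + C * ‖w‖ := by
    refine (norm_add_le _ _).trans ?_
    rw [norm_smul, norm_smul, Real.norm_eq_abs, Real.norm_eq_abs]
    gcongr
    exact mul_le_of_le_one_left (norm_nonneg _) ha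
  have h2 := pow_le_pow_left₀ (norm_nonneg _) h1 2
  nlinarith [sq_nonneg (‖z‖ - C * ‖w‖)]

theorem Theta_mul_le (h : IsC1HalfPlane u du) (γ : ℝ)
    (hu : IntegrableOn (fun p => ‖u p‖ ^ 2) {q : ℝ × ℝ | 0 < q.2})
    (hm : IntegrableOn (magneticDensity u du) {q : ℝ × ℝ | 0 < q.2})
    (hb : Integrable fun x : ℝ => ‖u (x, 0)‖ ^ 2) :
    Theta γ * (∫ p in {q : ℝ × ℝ | 0 < q.2}, ‖u p‖ ^ 2) ≤ magneticForm γ u du := by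
  obtain ⟨η, C, hη, hηs, hη1, hηd, hηt, hηdt⟩ := exists_cutoff (ℝ × ℝ)
  have hηdv : ∀ n p v, ‖v‖ = 1 → |fderiv ℝ (η n) p v| ≤ C := fun n p v hv => by
    have := (fderiv ℝ (η n) p).le_opNorm v
    rw [hv, mul_one] at this
    exact this.trans (hηd n p)
  have hv1 : ‖((1:ℝ), (0:ℝ))‖ = 1 := by simp [Prod.norm_def]
  have hv2 : ‖((0:ℝ), (1:ℝ))‖ = 1 := by simp [Prod.norm_def]
  have hηu : ∀ n p, ‖η n p • u p‖ ^ 2 ≤ ‖u p‖ ^ 2 := fun n p => by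
    rw [norm_smul, Real.norm_eq_abs]
    exact pow_le_pow_left₀ (by positivity) (mul_le_of_le_one_left (norm_nonneg _) (hη1 n p)) 2
  have hlim : ∀ p, Tendsto (fun n => ‖η n p • u p‖ ^ 2) atTop (𝓝 (‖u p‖ ^ 2)) := fun p => by
    simpa using (((hηt p).smul_const (u p)).norm.pow 2)
  have t0 : Tendsto (fun n => ∫ p in {q : ℝ × ℝ | 0 < q.2}, ‖η n p • u p‖ ^ 2) atTop
      (𝓝 (∫ p in {q : ℝ × ℝ | 0 < q.2}, ‖u p‖ ^ 2)) := by
    refine tendsto_integral_of_dominated_convergence _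
      (fun n => aestronglyMeasurable ((h.smul (hη n)).cont.norm.pow 2)) hu
      (fun n => ae_of_all _ fun p => ?_) (ae_of_all _ hlim)
    rw [Real.norm_of_nonneg (by positivity)]
    exact hηu n p
  have tb : Tendsto (fun n => ∫ x : ℝ, ‖η n (x, 0) • u (x, 0)‖ ^ 2) atTop
      (𝓝 (∫ x : ℝ, ‖u (x, 0)‖ ^ 2)) := by
    refine tendsto_integral_of_dominated_convergence _ (fun n => ?_) hb
      (fun n => ae_of_all _ fun x => ?_) (ae_of_all _ fun x => hlim _)
    · have hc : Continuous fun x : ℝ => η n (x, 0) • u (x, 0) :=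
        (h.smul (hη n)).cont.comp_continuous (f := fun x : ℝ => (x, (0:ℝ))) (by fun_prop)
          fun x => le_refl (0:ℝ)
      exact (hc.norm.pow 2).aestronglyMeasurable
    · rw [Real.norm_of_nonneg (by positivity)]
      exact hηu n _
  have tm : Tendsto (fun n => ∫ p in {q : ℝ × ℝ | 0 < q.2},
      magneticDensity (fun p => η n p • u p)
        (fun p => η n p • du p + (fderiv ℝ (η n) p).smulRight (u p)) p) atTop
      (𝓝 (∫ p in {q : ℝ × ℝ | 0 < q.2}, magneticDensity u du p)) := by
    refine tendsto_integral_of_dominated_convergence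
      (fun p => 2 * magneticDensity u du p + 4 * C ^ 2 * ‖u p‖ ^ 2)
      (fun n => aestronglyMeasurable (h.smul (hη n)).continuousOn_magneticDensity)
      ((hm.const_mul _).add (hu.const_mul _))
      (fun n => ae_of_all _ fun p => ?_) (ae_of_all _ fun p => ?_)
    · rw [Real.norm_of_nonneg (by unfold magneticDensity; positivity), magneticDensity_smul_eq]
      refine (add_le_add (norm_smul_add_smul_sq_le (hη1 n p) (hηdv n p _ hv1) _ _)
        (norm_smul_add_smul_sq_le (hη1 n p) (hηdv n p _ hv2) _ _)).trans_eq ?_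
      unfold magneticDensity
      ring
    · simp only [magneticDensity_smul_eq]
      have hd0 : ∀ v, Tendsto (fun n => fderiv ℝ (η n) p v) atTop (𝓝 0) := fun v => by
        simpa [Function.comp_def] using
          ((ContinuousLinearMap.apply ℝ ℝ v).continuous.tendsto 0).comp (hηdt p)
      have hz : ∀ (z : ℂ) v, Tendsto (fun n => ‖η n p • z + fderiv ℝ (η n) p v • u p‖ ^ 2) atTop
          (𝓝 (‖z‖ ^ 2)) := fun z v => by
        simpa using ((((hηt p).smul_const z).add ((hd0 v).smul_const (u p))).norm.pow 2)
      exact (hz _ _).add (hz _ _)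
  refine le_of_tendsto_of_tendsto' (t0.const_mul (Theta γ)) (tm.add (tb.const_mul γ)) fun n => ?_
  refine (h.smul (hη n)).Theta_mul_le_of_compact γ (hηs n) (fun p hp => ?_) (fun p hp => ?_)
  · simp [image_eq_zero_of_notMem_tsupport hp]
  · have : fderiv ℝ (η n) p = 0 := image_eq_zero_of_notMem_tsupport
      (fun hp' => hp (tsupport_fderiv_subset ℝ hp'))
    rw [this, image_eq_zero_of_notMem_tsupport hp]
    ext <;> simp

theorem integral_pos (h : IsC1HalfPlane u du)
    (hu : IntegrableOn (fun p => ‖u p‖ ^ 2) {q : ℝ × ℝ | 0 < q.2})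
    (hne : ∃ p : ℝ × ℝ, 0 ≤ p.2 ∧ u p ≠ 0) :
    0 < ∫ p in {q : ℝ × ℝ | 0 < q.2}, ‖u p‖ ^ 2 := by
  by_contra hcon
  have hz : ∫ p in {q : ℝ × ℝ | 0 < q.2}, ‖u p‖ ^ 2 = 0 :=
    le_antisymm (not_lt.1 hcon) (integral_nonneg fun x => by positivity)
  have hz2 := (setIntegral_eq_zero_iff_of_nonneg_ae
    (ae_of_all _ fun x => by positivity) hu).1 hz
  have ho : IsOpen {q : ℝ × ℝ | 0 < q.2} := isOpen_lt continuous_const continuous_snd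
  have hz3 := Measure.eqOn_open_of_ae_eq hz2 ho
    ((h.cont.mono halfPlane_subset).norm.pow 2) continuousOn_const
  obtain ⟨p, hp, hup⟩ := hne
  apply hup
  have hcl : closure {q : ℝ × ℝ | 0 < q.2} = {q : ℝ × ℝ | 0 ≤ q.2} := by
    rw [halfPlane_eq_prod, closure_prod_eq, closure_univ, closure_Ioi]
    ext; simp
  have hz4 : EqOn (fun p => ‖u p‖ ^ 2) (fun _ => 0) {q : ℝ × ℝ | 0 ≤ q.2} :=
    hz3.of_subset_closure (h.cont.norm.pow 2) continuousOn_const halfPlane_subset hcl.ge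
  simpa using hz4 hp

end IsC1HalfPlane

theorem integrable_sq_mul_exp_neg_mul_sq {b : ℝ} (hb : 0 < b) :
    Integrable fun x : ℝ => x ^ 2 * Real.exp (-b * x ^ 2) := by
  simpa using integrable_rpow_mul_exp_neg_mul_sq hb (s := 2) (by norm_num)

/-- The second moment of a Gaussian, relative to its mass. -/
theorem integral_sq_mul_exp_neg_mul_sq {b : ℝ} (hb : 0 < b) :
    2 * b * ∫ x : ℝ, x ^ 2 * Real.exp (-b * x ^ 2) = ∫ x : ℝ, Real.exp (-b * x ^ 2) := by
  have hd : ∀ x : ℝ, HasDerivAt (fun x : ℝ => x * Real.exp (-b * x ^ 2))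
      (Real.exp (-b * x ^ 2) - 2 * b * (x ^ 2 * Real.exp (-b * x ^ 2))) x := fun x => by
    have h1 : HasDerivAt (fun x : ℝ => -b * x ^ 2) (-b * (2 * x)) x := by
      simpa using (hasDerivAt_pow 2 x).const_mul (-b)
    refine ((hasDerivAt_id x).mul h1.exp).congr_deriv ?_
    simp only [id]
    ring
  have hi := (integrable_sq_mul_exp_neg_mul_sq hb).const_mul (2 * b)
  have h0 := integral_eq_zero_of_hasDerivAt_of_integrable hd
    ((integrable_exp_neg_mul_sq hb).sub hi) (integrable_mul_exp_neg_mul_sq hb)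
  rw [integral_sub (integrable_exp_neg_mul_sq hb) hi, integral_const_mul] at h0
  linarith

/-- The half-plane trial function `e^{i(xt/2 - ξx)} e^{-bx²} F(t)`. -/
noncomputable def gaussianTrial (b ξ : ℝ) (F : ℝ → ℂ) (p : ℝ × ℝ) : ℂ :=
  Complex.exp (((p.1 * p.2 / 2 - ξ * p.1 : ℝ) : ℂ) * Complex.I + ((-b * p.1 ^ 2 : ℝ) : ℂ)) * F p.2

namespace gaussianTrial

variable {b ξ : ℝ} {F : ℝ → ℂ}

theorem norm_cexp_sq (b ξ : ℝ) (p : ℝ × ℝ) :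
    ‖Complex.exp (((p.1 * p.2 / 2 - ξ * p.1 : ℝ) : ℂ) * Complex.I + ((-b * p.1 ^ 2 : ℝ) : ℂ))‖ ^ 2
      = Real.exp (-(2 * b) * p.1 ^ 2) := by
  rw [Complex.exp_add, norm_mul, Complex.norm_exp_ofReal_mul_I, one_mul, ← Complex.ofReal_exp,
    Complex.norm_real, Real.norm_of_nonneg (Real.exp_pos _).le, ← Real.exp_nat_mul]
  congr 1
  push_cast
  ring

theorem norm_sq_eq (p : ℝ × ℝ) :
    ‖gaussianTrial b ξ F p‖ ^ 2 = Real.exp (-(2 * b) * p.1 ^ 2) * ‖F p.2‖ ^ 2 := by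
  rw [gaussianTrial, norm_mul, mul_pow, norm_cexp_sq]

theorem contDiff (hF : ContDiff ℝ 1 F) : ContDiff ℝ 1 (gaussianTrial b ξ F) := by
  have h1 : ContDiff ℝ 1 fun p : ℝ × ℝ => p.1 * p.2 / 2 - ξ * p.1 := by fun_prop
  have h2 : ContDiff ℝ 1 fun p : ℝ × ℝ => -b * p.1 ^ 2 := by fun_prop
  exact (((Complex.ofRealCLM.contDiff.comp h1).mul contDiff_const).add
    (Complex.ofRealCLM.contDiff.comp h2)).cexp.mul (hF.comp contDiff_snd)

theorem isC1HalfPlane (hF : ContDiff ℝ 1 F) :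
    IsC1HalfPlane (gaussianTrial b ξ F) (fderiv ℝ (gaussianTrial b ξ F)) where
  cont := (contDiff hF).continuous.continuousOn
  deriv p _ := ((contDiff hF).differentiable one_ne_zero p).hasFDerivAt.hasFDerivWithinAt
  cont_deriv := ((contDiff hF).continuous_fderiv one_ne_zero).continuousOn

theorem magneticDensity_eq (hF : ContDiff ℝ 1 F) (p : ℝ × ℝ) :
    magneticDensity (gaussianTrial b ξ F) (fderiv ℝ (gaussianTrial b ξ F)) p
      = Real.exp (-(2 * b) * p.1 ^ 2) * (‖deriv F p.2‖ ^ 2 + (p.2 - ξ) ^ 2 * ‖F p.2‖ ^ 2)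
        + 4 * b ^ 2 * (p.1 ^ 2 * Real.exp (-(2 * b) * p.1 ^ 2)) * ‖F p.2‖ ^ 2 := by
  obtain ⟨x, t⟩ := p
  set e := Complex.exp (((x * t / 2 - ξ * x : ℝ) : ℂ) * Complex.I + ((-b * x ^ 2 : ℝ) : ℂ)) with he
  have hd := ((contDiff (b := b) (ξ := ξ) hF).differentiable one_ne_zero (x, t)).hasFDerivAt
  have hx : fderiv ℝ (gaussianTrial b ξ F) (x, t) (1, 0)
      = e * (((t / 2 - ξ : ℝ) : ℂ) * Complex.I + ((-b * (2 * x) : ℝ) : ℂ)) * F t := by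
    have h1 : HasDerivAt (fun x : ℝ => (x, t)) ((1:ℝ), (0:ℝ)) x :=
      (hasDerivAt_id x).prodMk (hasDerivAt_const x t)
    refine (hd.comp_hasDerivAt x h1).unique ?_
    have h2 : HasDerivAt (fun x : ℝ => x * t / 2 - ξ * x) (t / 2 - ξ) x := by
      simpa [Pi.sub_def] using
        (((hasDerivAt_id x).mul_const t).div_const 2).sub ((hasDerivAt_id x).const_mul ξ)
    have h3 : HasDerivAt (fun x : ℝ => -b * x ^ 2) (-b * (2 * x)) x := by
      simpa using (hasDerivAt_pow 2 x).const_mul (-b)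
    exact ((h2.ofReal_comp.mul_const Complex.I).add h3.ofReal_comp).cexp.mul_const (F t)
  have ht : fderiv ℝ (gaussianTrial b ξ F) (x, t) (0, 1)
      = e * (((x / 2 : ℝ) : ℂ) * Complex.I) * F t + e * deriv F t := by
    have h1 : HasDerivAt (fun s : ℝ => (x, s)) ((0:ℝ), (1:ℝ)) t :=
      (hasDerivAt_const t x).prodMk (hasDerivAt_id t)
    refine (hd.comp_hasDerivAt t h1).unique ?_
    have h2 : HasDerivAt (fun s : ℝ => x * s / 2 - ξ * x) (x / 2) t := by
      simpa using (((hasDerivAt_id t).const_mul x).div_const 2).sub_const (ξ * x)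
    exact ((h2.ofReal_comp.mul_const Complex.I).add_const ((-b * x ^ 2 : ℝ) : ℂ)).cexp.mul
      (hF.differentiable one_ne_zero t).hasDerivAt
  have hn := norm_cexp_sq b ξ (x, t)
  have e1 : fderiv ℝ (gaussianTrial b ξ F) (x, t) (1, 0)
      + Complex.I * ((t : ℂ) / 2) * gaussianTrial b ξ F (x, t)
      = e * F t * (((-b * (2 * x) : ℝ) : ℂ) + ((t - ξ : ℝ) : ℂ) * Complex.I) := by
    rw [hx, show gaussianTrial b ξ F (x, t) = e * F t from rfl]
    push_cast
    ring
  have e2 : fderiv ℝ (gaussianTrial b ξ F) (x, t) (0, 1)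
      - Complex.I * ((x : ℂ) / 2) * gaussianTrial b ξ F (x, t) = e * deriv F t := by
    rw [ht, show gaussianTrial b ξ F (x, t) = e * F t from rfl]
    push_cast
    ring
  have e3 : ‖((-b * (2 * x) : ℝ) : ℂ) + ((t - ξ : ℝ) : ℂ) * Complex.I‖ ^ 2
      = (-b * (2 * x)) ^ 2 + (t - ξ) ^ 2 := by
    rw [← Complex.normSq_eq_norm_sq, Complex.normSq_add_mul_I]
  simp only at hn
  simp only [magneticDensity, e1, e2, norm_mul, mul_pow, hn, he] at e3 ⊢
  rw [e3]
  ring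

theorem integrable_norm_sq (hb : 0 < b) (hF : ContDiff ℝ 1 F) (hs : HasCompactSupport F) :
    IntegrableOn (fun p => ‖gaussianTrial b ξ F p‖ ^ 2) {q : ℝ × ℝ | 0 < q.2} := by
  rw [IntegrableOn, volume_restrict_halfPlane]
  simp only [norm_sq_eq]
  exact (integrable_exp_neg_mul_sq (by positivity)).mul_prod (AdmissibleHL.of_contDiff hF hs).memL2

theorem integrable_magneticDensity (hb : 0 < b) (hF : ContDiff ℝ 1 F) (hs : HasCompactSupport F) :
    IntegrableOn (magneticDensity (gaussianTrial b ξ F) (fderiv ℝ (gaussianTrial b ξ F)))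
      {q : ℝ × ℝ | 0 < q.2} := by
  have hA := AdmissibleHL.of_contDiff hF hs
  rw [IntegrableOn, volume_restrict_halfPlane, funext (magneticDensity_eq hF)]
  exact ((integrable_exp_neg_mul_sq (by positivity)).mul_prod
    (hA.memL2'.add (hA.integrable_potential ξ))).add
    (((integrable_sq_mul_exp_neg_mul_sq (by positivity)).const_mul _).mul_prod hA.memL2)

theorem integrable_boundary (hb : 0 < b) :
    Integrable fun x : ℝ => ‖gaussianTrial b ξ F (x, 0)‖ ^ 2 := by
  simp only [norm_sq_eq]
  exact (integrable_exp_neg_mul_sq (by positivity)).mul_const _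

theorem integral_norm_sq :
    ∫ p in {q : ℝ × ℝ | 0 < q.2}, ‖gaussianTrial b ξ F p‖ ^ 2
      = (∫ x : ℝ, Real.exp (-(2 * b) * x ^ 2)) * ∫ t in Ioi (0:ℝ), ‖F t‖ ^ 2 := by
  rw [volume_restrict_halfPlane]
  simp only [norm_sq_eq]
  exact integral_prod_mul (fun x : ℝ => Real.exp (-(2 * b) * x ^ 2)) fun t => ‖F t‖ ^ 2

theorem magneticForm_eq (γ : ℝ) (hb : 0 < b) (hF : ContDiff ℝ 1 F) (hs : HasCompactSupport F) :
    magneticForm γ (gaussianTrial b ξ F) (fderiv ℝ (gaussianTrial b ξ F))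
      = (∫ x : ℝ, Real.exp (-(2 * b) * x ^ 2))
        * (qform γ ξ F (deriv F) + b * ∫ t in Ioi (0:ℝ), ‖F t‖ ^ 2) := by
  have hA := AdmissibleHL.of_contDiff hF hs
  have hb2 : 0 < 2 * b := by positivity
  rw [magneticForm, volume_restrict_halfPlane, funext (magneticDensity_eq hF)]
  simp only [norm_sq_eq]
  have hq : IntegrableOn (fun t => ‖deriv F t‖ ^ 2 + (t - ξ) ^ 2 * ‖F t‖ ^ 2) (Ioi 0) :=
    hA.memL2'.add (hA.integrable_potential ξ)
  rw [integral_add ((integrable_exp_neg_mul_sq hb2).mul_prod hq)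
    (((integrable_sq_mul_exp_neg_mul_sq hb2).const_mul (4 * b ^ 2)).mul_prod hA.memL2),
    integral_prod_mul (fun x : ℝ => Real.exp (-(2 * b) * x ^ 2))
      fun t => ‖deriv F t‖ ^ 2 + (t - ξ) ^ 2 * ‖F t‖ ^ 2,
    integral_prod_mul (fun x : ℝ => 4 * b ^ 2 * (x ^ 2 * Real.exp (-(2 * b) * x ^ 2)))
      fun t => ‖F t‖ ^ 2, integral_const_mul, integral_mul_const, qform,
    ← integral_sq_mul_exp_neg_mul_sq hb2]
  ring

end gaussianTrial

/-- A lower bound for the half-plane form is a lower bound for each `q[γ,ξ]`, on smooth compactly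
supported functions. -/
theorem mul_le_qform_of_contDiff {γ σ : ℝ}
    (hσ : ∀ u du, IsC1HalfPlane u du → IntegrableOn (fun p => ‖u p‖ ^ 2) {q : ℝ × ℝ | 0 < q.2} →
      IntegrableOn (magneticDensity u du) {q : ℝ × ℝ | 0 < q.2} →
      Integrable (fun x : ℝ => ‖u (x, 0)‖ ^ 2) →
      σ * (∫ p in {q : ℝ × ℝ | 0 < q.2}, ‖u p‖ ^ 2) ≤ magneticForm γ u du)
    (ξ : ℝ) {F : ℝ → ℂ} (hF : ContDiff ℝ 1 F) (hs : HasCompactSupport F) :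
    σ * (∫ t in Ioi (0:ℝ), ‖F t‖ ^ 2) ≤ qform γ ξ F (deriv F) := by
  have key : ∀ b ∈ Ioi (0:ℝ), σ * (∫ t in Ioi (0:ℝ), ‖F t‖ ^ 2)
      ≤ qform γ ξ F (deriv F) + b * ∫ t in Ioi (0:ℝ), ‖F t‖ ^ 2 := by
    intro b hb
    have h := hσ _ _ (gaussianTrial.isC1HalfPlane (b := b) (ξ := ξ) hF)
      (gaussianTrial.integrable_norm_sq hb hF hs) (gaussianTrial.integrable_magneticDensity hb hF hs)
      (gaussianTrial.integrable_boundary hb)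
    rw [gaussianTrial.integral_norm_sq, gaussianTrial.magneticForm_eq γ hb hF hs,
      mul_left_comm] at h
    refine le_of_mul_le_mul_left h ?_
    rw [integral_gaussian]
    have : 0 < b := hb
    positivity
  have hlim : Tendsto (fun b : ℝ => qform γ ξ F (deriv F) + b * ∫ t in Ioi (0:ℝ), ‖F t‖ ^ 2)
      (𝓝[>] 0) (𝓝 (qform γ ξ F (deriv F) + 0 * ∫ t in Ioi (0:ℝ), ‖F t‖ ^ 2)) :=
    Tendsto.mono_left (Continuous.tendsto (by fun_prop) 0) nhdsWithin_le_nhds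
  rw [zero_mul, add_zero] at hlim
  exact ge_of_tendsto hlim (eventually_mem_nhdsWithin.mono key)

theorem norm_sq_sub_norm_sq_le {ε : ℝ} (hε : 0 < ε) (a b : ℂ) :
    |‖a‖ ^ 2 - ‖b‖ ^ 2| ≤ (1 + 1 / ε) * ‖a - b‖ ^ 2 + ε * ‖b‖ ^ 2 := by
  have h1 : |‖a‖ - ‖b‖| ≤ ‖a - b‖ := abs_norm_sub_norm_le a b
  have h2 : ‖a‖ + ‖b‖ ≤ ‖a - b‖ + 2 * ‖b‖ := by
    linarith [norm_le_norm_add_norm_sub' a b]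
  have h3 : |‖a‖ ^ 2 - ‖b‖ ^ 2| = |‖a‖ - ‖b‖| * (‖a‖ + ‖b‖) := by
    rw [sq_sub_sq, abs_mul, abs_of_nonneg (by positivity : 0 ≤ ‖a‖ + ‖b‖), mul_comm]
  have h4 : |‖a‖ - ‖b‖| * (‖a‖ + ‖b‖) ≤ ‖a - b‖ * (‖a - b‖ + 2 * ‖b‖) := by gcongr
  have h5 : 2 * (‖a - b‖ * ‖b‖) ≤ 1 / ε * ‖a - b‖ ^ 2 + ε * ‖b‖ ^ 2 := by
    have : 1 / ε * ‖a - b‖ ^ 2 + ε * ‖b‖ ^ 2 - 2 * (‖a - b‖ * ‖b‖)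
        = (‖a - b‖ - ε * ‖b‖) ^ 2 / ε := by
      field_simp
      ring
    have h6 : 0 ≤ (‖a - b‖ - ε * ‖b‖) ^ 2 / ε := by positivity
    linarith
  rw [h3]
  nlinarith

theorem MeasureTheory.MemLp.integrable_norm_sq {α : Type*} [MeasurableSpace α] {μ : Measure α}
    {f : α → ℂ} (hf : MemLp f 2 μ) : Integrable (fun x => ‖f x‖ ^ 2) μ :=
  (memLp_two_iff_integrable_sq_norm hf.1).1 hf

theorem norm_mul_smul_sq (c a : ℝ) (z : ℂ) : ‖(c * a) • z‖ ^ 2 = c ^ 2 * ‖a • z‖ ^ 2 := by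
  rw [mul_smul, norm_smul, mul_pow, Real.norm_eq_abs, sq_abs]

/-- Convergence in `L²` implies convergence of the squared norms. -/
theorem tendsto_integral_norm_sq {α : Type*} [MeasurableSpace α] {μ : Measure α}
    {f : ℕ → α → ℂ} {g : α → ℂ} (hf : ∀ n, Integrable (fun x => ‖f n x‖ ^ 2) μ)
    (hg : Integrable (fun x => ‖g x‖ ^ 2) μ) (hfg : ∀ n, Integrable (fun x => ‖f n x - g x‖ ^ 2) μ)
    (hlim : Tendsto (fun n => ∫ x, ‖f n x - g x‖ ^ 2 ∂μ) atTop (𝓝 0)) :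
    Tendsto (fun n => ∫ x, ‖f n x‖ ^ 2 ∂μ) atTop (𝓝 (∫ x, ‖g x‖ ^ 2 ∂μ)) := by
  have hB : 0 ≤ ∫ x, ‖g x‖ ^ 2 ∂μ := integral_nonneg fun x => by positivity
  have key : ∀ ε > 0, ∀ n, |(∫ x, ‖f n x‖ ^ 2 ∂μ) - ∫ x, ‖g x‖ ^ 2 ∂μ|
      ≤ (1 + 1 / ε) * (∫ x, ‖f n x - g x‖ ^ 2 ∂μ) + ε * ∫ x, ‖g x‖ ^ 2 ∂μ := by
    intro ε hε n
    rw [← integral_sub (hf n) hg, ← integral_const_mul, ← integral_const_mul,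
      ← integral_add ((hfg n).const_mul _) (hg.const_mul _)]
    refine norm_integral_le_of_norm_le (f := fun x => ‖f n x‖ ^ 2 - ‖g x‖ ^ 2)
      (((hfg n).const_mul (1 + 1 / ε)).add (hg.const_mul ε)) (ae_of_all _ fun x => ?_)
    exact norm_sq_sub_norm_sq_le hε (f n x) (g x)
  rw [Metric.tendsto_atTop']
  intro e he
  set ε := e / (2 * ((∫ x, ‖g x‖ ^ 2 ∂μ) + 1)) with hε
  have hε0 : 0 < ε := by positivity
  have h1 : ε * ∫ x, ‖g x‖ ^ 2 ∂μ ≤ e / 2 := by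
    rw [hε, div_mul_eq_mul_div, div_le_div_iff₀ (by positivity) (by positivity)]
    nlinarith
  have h2 : Tendsto (fun n => (1 + 1 / ε) * ∫ x, ‖f n x - g x‖ ^ 2 ∂μ) atTop (𝓝 0) := by
    simpa using hlim.const_mul (1 + 1 / ε)
  obtain ⟨N, hN⟩ := eventually_atTop.1 (h2.eventually_lt_const (half_pos he))
  refine ⟨N, fun n hn => ?_⟩
  rw [Real.dist_eq]
  linarith [key ε hε0 n, hN n hn.le]

namespace AdmissibleHL

variable {f f' : ℝ → ℂ}

theorem aestronglyMeasurable_deriv (h : AdmissibleHL f f') :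
    AEStronglyMeasurable f' (volume.restrict (Ioi 0)) := by
  have hU : Ioi (0:ℝ) = ⋃ n : ℕ, Ioc 0 (n:ℝ) := by
    ext x
    simp only [mem_Ioi, mem_iUnion, mem_Ioc, exists_and_left]
    exact ⟨fun hx => ⟨hx, exists_nat_ge x⟩, fun hx => hx.1⟩
  rw [hU]
  exact AEStronglyMeasurable.iUnion fun n =>
    ((intervalIntegrable_iff_integrableOn_Ioc_of_le n.cast_nonneg).1
      (h.locInt n (mem_Ici.2 n.cast_nonneg))).aestronglyMeasurable

theorem memLp_deriv (h : AdmissibleHL f f') : MemLp f' 2 (volume.restrict (Ioi 0)) :=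
  (memLp_two_iff_integrable_sq_norm h.aestronglyMeasurable_deriv).2 h.memL2'

theorem aestronglyMeasurable (h : AdmissibleHL f f') :
    AEStronglyMeasurable f (volume.restrict (Ioi 0)) :=
  (h.cont.mono Ioi_subset_Ici_self).aestronglyMeasurable measurableSet_Ioi

theorem memLp (h : AdmissibleHL f f') : MemLp f 2 (volume.restrict (Ioi 0)) :=
  (memLp_two_iff_integrable_sq_norm h.aestronglyMeasurable).2 h.memL2

/-- The derivative is an `L²` limit of continuous functions. -/
theorem exists_continuous_approx (h : AdmissibleHL f f') :
    ∃ g : ℕ → ℝ → ℂ, (∀ n, Continuous (g n)) ∧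
      (∀ n, MemLp (g n) 2 (volume.restrict (Ioi 0))) ∧
      Tendsto (fun n => ∫ t in Ioi (0:ℝ), ‖g n t - f' t‖ ^ 2) atTop (𝓝 0) := by
  have h2 : MemLp f' (ENNReal.ofReal 2) (volume.restrict (Ioi 0)) := by
    simpa using h.memLp_deriv
  have hex : ∀ n : ℕ, ∃ g : ℝ → ℂ, Continuous g ∧ MemLp g 2 (volume.restrict (Ioi 0)) ∧
      ∫ t in Ioi (0:ℝ), ‖g t - f' t‖ ^ 2 ≤ 1 / ((n:ℝ) + 1) := fun n => by
    obtain ⟨g, -, hg, hc, hm⟩ :=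
      h2.exists_hasCompactSupport_integral_rpow_sub_le two_pos (ε := 1 / ((n:ℝ) + 1)) (by positivity)
    refine ⟨g, hc, by simpa using hm, ?_⟩
    simpa [norm_sub_rev] using hg
  choose g hg hm hd using hex
  exact ⟨g, hg, hm, squeeze_zero (fun n => integral_nonneg fun t => by positivity) hd
    tendsto_one_div_add_atTop_nhds_zero_nat⟩

/-- The primitive of `g` with the boundary value of `f` is close to `f` if `g` is close to the
derivative of `f` in `L²`. -/
theorem norm_primitive_sub_sq_le (h : AdmissibleHL f f') {g : ℝ → ℂ} (hg : Continuous g)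
    (hg2 : MemLp g 2 (volume.restrict (Ioi 0))) {t a : ℝ} (ht : 0 ≤ t) (hta : t ≤ a) :
    ‖(f 0 + ∫ s in (0:ℝ)..t, g s) - f t‖ ^ 2 ≤ a * ∫ s in Ioi (0:ℝ), ‖g s - f' s‖ ^ 2 := by
  have e : (f 0 + ∫ s in (0:ℝ)..t, g s) - f t = ∫ s in (0:ℝ)..t, (g s - f' s) := by
    rw [intervalIntegral.integral_sub (hg.intervalIntegrable _ _) (h.locInt t ht), h.ac t ht]
    ring
  rw [e]
  exact norm_intervalIntegral_sq_le ht hta ((hg.intervalIntegrable _ _).sub (h.locInt t ht))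
    (hg2.sub h.memLp_deriv).integrable_norm_sq

end AdmissibleHL

theorem MeasureTheory.MemLp.smul_of_hasCompactSupport {θ : ℝ → ℝ} (hθ : Continuous θ)
    (hs : HasCompactSupport θ) {g : ℝ → ℂ} (hg : MemLp g 2 (volume.restrict (Ioi 0))) :
    MemLp (fun t => θ t • g t) 2 (volume.restrict (Ioi 0)) := by
  obtain ⟨C, hC⟩ := hs.exists_bound_of_continuous hθ
  refine hg.of_le_mul (c := C) (hθ.aestronglyMeasurable.smul hg.1) (ae_of_all _ fun t => ?_)
  rw [norm_smul]
  gcongr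
  exact hC t

theorem memLp_smul_of_continuous {θ : ℝ → ℝ} (hθ : Continuous θ)
    (hs : HasCompactSupport θ) {g : ℝ → ℂ} (hg : Continuous g) :
    MemLp (fun t => θ t • g t) 2 (volume.restrict (Ioi 0)) :=
  ((hθ.smul hg).memLp_of_hasCompactSupport hs.smul_right).restrict _

theorem tendsto_integral_norm_smul_sub_sq {θ : ℝ → ℝ} (hθ : Continuous θ)
    (hs : HasCompactSupport θ) {a : ℝ} (ha : ∀ t, a < t → θ t = 0) {G : ℕ → ℝ → ℂ} {f : ℝ → ℂ}
    {d : ℕ → ℝ} (hd : Tendsto d atTop (𝓝 0))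
    (hGf : ∀ n t, 0 ≤ t → t ≤ a → ‖G n t - f t‖ ^ 2 ≤ a * d n) :
    Tendsto (fun n => ∫ t in Ioi (0:ℝ), ‖θ t • G n t - θ t • f t‖ ^ 2) atTop (𝓝 0) := by
  have hi : Integrable (fun t => θ t ^ 2) :=
    (hθ.pow 2).integrable_of_hasCompactSupport (by simpa only [sq] using hs.mul_left)
  refine squeeze_zero (g := fun n => (∫ t in Ioi (0:ℝ), θ t ^ 2) * (a * d n))
    (fun n => integral_nonneg fun t => by positivity) (fun n => ?_) ?_
  · rw [← integral_mul_const]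
    refine integral_mono_of_nonneg (ae_of_all _ fun t => by positivity)
      (hi.integrableOn.mul_const _) ?_
    filter_upwards [ae_restrict_mem measurableSet_Ioi] with t ht
    rw [← smul_sub, norm_smul, mul_pow, Real.norm_eq_abs, sq_abs]
    rcases le_or_gt t a with hta | hta
    · exact mul_le_mul_of_nonneg_left (hGf n t (le_of_lt ht) hta) (sq_nonneg _)
    · simp [ha t hta]
  · simpa using (hd.const_mul a).const_mul (∫ t in Ioi (0:ℝ), θ t ^ 2)

namespace AdmissibleHL

variable {f f' : ℝ → ℂ}

theorem mul_le_of_cutoff (h : AdmissibleHL f f') {γ σ ξ : ℝ}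
    (hσ : ∀ F : ℝ → ℂ, ContDiff ℝ 1 F → HasCompactSupport F →
      σ * (∫ t in Ioi (0:ℝ), ‖F t‖ ^ 2) ≤ qform γ ξ F (deriv F))
    {η : ℝ → ℝ} (hη : ContDiff ℝ 1 η) (hs : HasCompactSupport η) :
    σ * (∫ t in Ioi (0:ℝ), ‖η t • f t‖ ^ 2)
      ≤ (∫ t in Ioi (0:ℝ), ‖η t • f' t + deriv η t • f t‖ ^ 2)
        + (∫ t in Ioi (0:ℝ), ‖((t - ξ) * η t) • f t‖ ^ 2) + γ * ‖η 0 • f 0‖ ^ 2 := by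
  obtain ⟨g, hgc, hgm, hd⟩ := h.exists_continuous_approx
  set G : ℕ → ℝ → ℂ := fun n t => f 0 + ∫ s in (0:ℝ)..t, g n s with hG
  set d : ℕ → ℝ := fun n => ∫ t in Ioi (0:ℝ), ‖g n t - f' t‖ ^ 2
  have hGd : ∀ n t, HasDerivAt (G n) (g n t) t := fun n t =>
    (intervalIntegral.integral_hasDerivAt_right ((hgc n).intervalIntegrable _ _)
      ((hgc n).stronglyMeasurableAtFilter _ _) (hgc n).continuousAt).const_add _
  have hGc : ∀ n, Continuous (G n) := fun n =>
    continuous_iff_continuousAt.2 fun t => (hGd n t).continuousAt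
  obtain ⟨a, ha⟩ : ∃ a, ∀ t ∈ tsupport η, t ≤ a := hs.isCompact.bddAbove
  have hη0 : ∀ t, a < t → η t = 0 := fun t ht =>
    image_eq_zero_of_notMem_tsupport fun hm => ht.not_ge (ha t hm)
  have hη'0 : ∀ t, a < t → deriv η t = 0 := fun t ht => image_eq_zero_of_notMem_tsupport fun hm =>
    ht.not_ge (ha t (tsupport_deriv_subset hm))
  have hηc := hη.continuous
  have hη'c : Continuous (deriv η) := hη.continuous_deriv le_rfl
  have hwc : Continuous fun t => (t - ξ) * η t := by fun_prop
  have hws : HasCompactSupport fun t => (t - ξ) * η t := hs.mul_left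
  have hGf : ∀ n t, 0 ≤ t → t ≤ a → ‖G n t - f t‖ ^ 2 ≤ a * d n := fun n t ht hta =>
    h.norm_primitive_sub_sq_le (hgc n) (hgm n) ht hta
  have conv : ∀ θ : ℝ → ℝ, Continuous θ → HasCompactSupport θ → (∀ t, a < t → θ t = 0) →
      Tendsto (fun n => ∫ t in Ioi (0:ℝ), ‖θ t • G n t‖ ^ 2) atTop
        (𝓝 (∫ t in Ioi (0:ℝ), ‖θ t • f t‖ ^ 2)) := fun θ hθ hθs hθ0 => by
    have m1 := fun n => memLp_smul_of_continuous hθ hθs (hGc n)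
    have m2 := h.memLp.smul_of_hasCompactSupport hθ hθs
    exact tendsto_integral_norm_sq (fun n => (m1 n).integrable_norm_sq) m2.integrable_norm_sq
      (fun n => ((m1 n).sub m2).integrable_norm_sq)
      (tendsto_integral_norm_smul_sub_sq hθ hθs hθ0 hd hGf)
  have hFd : ∀ n t, HasDerivAt (fun t => η t • G n t) (η t • g n t + deriv η t • G n t) t :=
    fun n t => (hη.differentiable one_ne_zero t).hasDerivAt.smul (hGd n t)
  have hFd' : ∀ n, deriv (fun t => η t • G n t) = fun t => η t • g n t + deriv η t • G n t :=
    fun n => funext fun t => (hFd n t).deriv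
  have hF : ∀ n, ContDiff ℝ 1 fun t => η t • G n t := fun n => by
    rw [contDiff_one_iff_deriv, hFd' n]
    exact ⟨fun t => (hFd n t).differentiableAt,
      (hηc.smul (hgc n)).add (hη'c.smul (hGc n))⟩
  have convD : Tendsto (fun n => ∫ t in Ioi (0:ℝ), ‖η t • g n t + deriv η t • G n t‖ ^ 2) atTop
      (𝓝 (∫ t in Ioi (0:ℝ), ‖η t • f' t + deriv η t • f t‖ ^ 2)) := by
    have m1 := fun n => (memLp_smul_of_continuous hηc hs (hgc n)).add
      (memLp_smul_of_continuous hη'c hs.deriv (hGc n))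
    have m2 := (h.memLp_deriv.smul_of_hasCompactSupport hηc hs).add
      (h.memLp.smul_of_hasCompactSupport hη'c hs.deriv)
    refine tendsto_integral_norm_sq (fun n => (m1 n).integrable_norm_sq) m2.integrable_norm_sq
      (fun n => ((m1 n).sub m2).integrable_norm_sq) ?_
    obtain ⟨C, hC⟩ := hs.exists_bound_of_continuous hηc
    have m3 := fun n => ((hgm n).sub h.memLp_deriv).integrable_norm_sq.const_mul (2 * C ^ 2)
    have m4 := fun n => ((memLp_smul_of_continuous hη'c hs.deriv (hGc n)).sub
      (h.memLp.smul_of_hasCompactSupport hη'c hs.deriv)).integrable_norm_sq.const_mul 2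
    have hlim := (hd.const_mul (2 * C ^ 2)).add
      ((tendsto_integral_norm_smul_sub_sq hη'c hs.deriv hη'0 hd hGf).const_mul 2)
    rw [mul_zero, mul_zero, add_zero] at hlim
    refine squeeze_zero (fun n => integral_nonneg fun t => by positivity) (fun n => ?_) hlim
    rw [← integral_const_mul, ← integral_const_mul]
    refine (integral_mono ((m1 n).sub m2).integrable_norm_sq ((m3 n).add (m4 n)) fun t => ?_).trans_eq
      (integral_add (m3 n) (m4 n))
    have e : η t • g n t + deriv η t • G n t - (η t • f' t + deriv η t • f t)
        = η t • (g n t - f' t) + (deriv η t • G n t - deriv η t • f t) := by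
      simp only [smul_sub]; ring
    have h1 : ‖η t • (g n t - f' t)‖ ≤ C * ‖g n t - f' t‖ := by
      rw [norm_smul]
      gcongr
      exact hC t
    have h2 := pow_le_pow_left₀ (norm_nonneg _) ((norm_add_le (η t • (g n t - f' t))
      (deriv η t • G n t - deriv η t • f t)).trans (add_le_add_left h1 _)) 2
    rw [← e] at h2
    refine h2.trans ?_
    simp only [Pi.add_apply, Pi.sub_apply]
    nlinarith [sq_nonneg (C * ‖g n t - f' t‖ - ‖deriv η t • G n t - deriv η t • f t‖)]
  refine le_of_tendsto_of_tendsto' ((conv η hηc hs hη0).const_mul σ)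
    ((convD.add (conv _ hwc hws fun t ht => by simp [hη0 t ht])).add_const (γ * ‖η 0 • f 0‖ ^ 2))
    fun n => ?_
  have hq := hσ _ (hF n) hs.smul_right
  rw [(of_contDiff (hF n) hs.smul_right).qform_eq, hFd' n] at hq
  refine hq.trans_eq ?_
  simp only [norm_mul_smul_sq]
  simp [hG]

/-- A lower bound for `q[γ,ξ]` on smooth compactly supported functions holds for all admissible
functions. -/
theorem mul_le_qform (h : AdmissibleHL f f') {γ σ ξ : ℝ}
    (hσ : ∀ F : ℝ → ℂ, ContDiff ℝ 1 F → HasCompactSupport F →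
      σ * (∫ t in Ioi (0:ℝ), ‖F t‖ ^ 2) ≤ qform γ ξ F (deriv F)) :
    σ * (∫ t in Ioi (0:ℝ), ‖f t‖ ^ 2) ≤ qform γ ξ f f' := by
  obtain ⟨η, C, hη, hηs, hη1, hηd, hηt, hηdt⟩ := exists_cutoff ℝ
  have hηd1 : ∀ n t, |deriv (η n) t| ≤ C := fun n t => by
    rw [← Real.norm_eq_abs, norm_deriv_eq_norm_fderiv]
    exact hηd n t
  have hηdt0 : ∀ t, Tendsto (fun n => deriv (η n) t) atTop (𝓝 0) := fun t => by
    refine squeeze_zero_norm (fun n => norm_deriv_eq_norm_fderiv.le) ?_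
    simpa using (hηdt t).norm
  have hle : ∀ n t, ‖η n t • f t‖ ^ 2 ≤ ‖f t‖ ^ 2 := fun n t => by
    rw [norm_smul, Real.norm_eq_abs]
    exact pow_le_pow_left₀ (by positivity) (mul_le_of_le_one_left (norm_nonneg _) (hη1 n t)) 2
  have hlim : ∀ t, Tendsto (fun n => ‖η n t • f t‖ ^ 2) atTop (𝓝 (‖f t‖ ^ 2)) := fun t => by
    simpa using (((hηt t).smul_const (f t)).norm.pow 2)
  have hηm := fun n => (hη n).continuous.aestronglyMeasurable (μ := volume.restrict (Ioi (0:ℝ)))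
  have t0 : Tendsto (fun n => ∫ t in Ioi (0:ℝ), ‖η n t • f t‖ ^ 2) atTop
      (𝓝 (∫ t in Ioi (0:ℝ), ‖f t‖ ^ 2)) := by
    refine tendsto_integral_of_dominated_convergence _
      (fun n => ((hηm n).smul h.aestronglyMeasurable).norm.pow 2) h.memL2
      (fun n => ae_of_all _ fun t => ?_) (ae_of_all _ hlim)
    rw [Real.norm_of_nonneg (by positivity)]
    exact hle n t
  have tw : Tendsto (fun n => ∫ t in Ioi (0:ℝ), ‖((t - ξ) * η n t) • f t‖ ^ 2) atTop
      (𝓝 (∫ t in Ioi (0:ℝ), (t - ξ) ^ 2 * ‖f t‖ ^ 2)) := by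
    simp only [norm_mul_smul_sq]
    refine tendsto_integral_of_dominated_convergence _ (fun n => ?_) (h.integrable_potential ξ)
      (fun n => ae_of_all _ fun t => ?_) (ae_of_all _ fun t => (hlim t).const_mul _)
    · have : Continuous fun t : ℝ => (t - ξ) ^ 2 := by fun_prop
      exact this.aestronglyMeasurable.mul (((hηm n).smul h.aestronglyMeasurable).norm.pow 2)
    · rw [Real.norm_of_nonneg (by positivity)]
      exact mul_le_mul_of_nonneg_left (hle n t) (sq_nonneg _)
  have td : Tendsto (fun n => ∫ t in Ioi (0:ℝ), ‖η n t • f' t + deriv (η n) t • f t‖ ^ 2) atTop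
      (𝓝 (∫ t in Ioi (0:ℝ), ‖f' t‖ ^ 2)) := by
    refine tendsto_integral_of_dominated_convergence
      (fun t => 2 * ‖f' t‖ ^ 2 + 2 * C ^ 2 * ‖f t‖ ^ 2) (fun n => ?_)
      ((h.memL2'.const_mul _).add (h.memL2.const_mul _))
      (fun n => ae_of_all _ fun t => ?_) (ae_of_all _ fun t => ?_)
    · exact (((hηm n).smul h.aestronglyMeasurable_deriv).add
        (((hη n).continuous_deriv le_rfl).aestronglyMeasurable.smul
          h.aestronglyMeasurable)).norm.pow 2
    · rw [Real.norm_of_nonneg (by positivity)]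
      exact IsC1HalfPlane.norm_smul_add_smul_sq_le (hη1 n t) (hηd1 n t) _ _
    · simpa using ((((hηt t).smul_const (f' t)).add ((hηdt0 t).smul_const (f t))).norm.pow 2)
  rw [h.qform_eq]
  exact le_of_tendsto_of_tendsto' (t0.const_mul σ) ((td.add tw).add ((hlim 0).const_mul γ))
    fun n => h.mul_le_of_cutoff hσ (hη n) (hηs n)

end AdmissibleHL

end

/-- The half-plane ground state energy: the infimum of the magnetic Rayleigh quotients
(with magnetic potential `A₀(x₁,x₂) = (−x₂/2, x₁/2)` and boundary term of weight `γ`)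
over admissible half-plane functions not identically zero equals
`Θ(γ) = inf_{ξ} μ⁽¹⁾(γ,ξ)`. -/
theorem halfPlane_groundStateEnergy_eq_Theta (γ : ℝ) :
    sInf { r : ℝ | ∃ (u : ℝ × ℝ → ℂ) (du : ℝ × ℝ → (ℝ × ℝ) →L[ℝ] ℂ),
      ContinuousOn u {q : ℝ × ℝ | 0 ≤ q.2} ∧
      (∀ p : ℝ × ℝ, 0 ≤ p.2 → HasFDerivWithinAt u (du p) {q : ℝ × ℝ | 0 ≤ q.2} p) ∧
      ContinuousOn du {q : ℝ × ℝ | 0 ≤ q.2} ∧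
      IntegrableOn (fun p => ‖u p‖ ^ 2) {q : ℝ × ℝ | 0 < q.2} ∧
      IntegrableOn (fun p : ℝ × ℝ =>
          ‖du p (1, 0) + Complex.I * ((p.2 : ℂ) / 2) * u p‖ ^ 2 +
          ‖du p (0, 1) - Complex.I * ((p.1 : ℂ) / 2) * u p‖ ^ 2)
        {q : ℝ × ℝ | 0 < q.2} ∧
      Integrable (fun x : ℝ => ‖u (x, 0)‖ ^ 2) ∧
      (∃ p : ℝ × ℝ, 0 ≤ p.2 ∧ u p ≠ 0) ∧
      r = ((∫ p in {q : ℝ × ℝ | 0 < q.2},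
              (‖du p (1, 0) + Complex.I * ((p.2 : ℂ) / 2) * u p‖ ^ 2 +
               ‖du p (0, 1) - Complex.I * ((p.1 : ℂ) / 2) * u p‖ ^ 2))
            + γ * ∫ x : ℝ, ‖u (x, 0)‖ ^ 2)
          / ∫ p in {q : ℝ × ℝ | 0 < q.2}, ‖u p‖ ^ 2 }
    = Theta γ := by
  apply le_antisymm
  · refine le_ciInf fun ξ => le_csInf (mu1_set_nonempty γ ξ) ?_
    rintro r ⟨f, f', h, hne, rfl⟩
    rw [le_div_iff₀ (h.integral_pos hne)]
    refine h.mul_le_qform fun F hF hs => mul_le_qform_of_contDiff ?_ ξ hF hs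
    intro u du hc hu hm hb
    by_cases hnu : ∃ p : ℝ × ℝ, 0 ≤ p.2 ∧ u p ≠ 0
    · rw [← le_div_iff₀ (hc.integral_pos hu hnu)]
      refine csInf_le ⟨Theta γ, ?_⟩
        ⟨u, du, hc.cont, hc.deriv, hc.cont_deriv, hu, hm, hb, hnu, rfl⟩
      rintro r ⟨v, dv, h1, h2, h3, hv, hdv, hvb, hnv, rfl⟩
      have hcv : IsC1HalfPlane v dv := ⟨h1, h2, h3⟩
      rw [le_div_iff₀ (hcv.integral_pos hv hnv)]
      exact hcv.Theta_mul_le γ hv hdv hvb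
    · have hz : ∫ p in {q : ℝ × ℝ | 0 < q.2}, ‖u p‖ ^ 2 = 0 := by
        refine setIntegral_eq_zero_of_forall_eq_zero fun p hp => ?_
        push Not at hnu
        simp [hnu p (halfPlane_subset hp)]
      simpa [hz] using hc.Theta_mul_le γ hu hm hb
  · obtain ⟨F, hF, hs, h0⟩ := exists_contDiff_hasCompactSupport
    refine le_csInf ⟨_, gaussianTrial 1 0 F, fderiv ℝ (gaussianTrial 1 0 F),
      (gaussianTrial.isC1HalfPlane hF).cont, (gaussianTrial.isC1HalfPlane hF).deriv,
      (gaussianTrial.isC1HalfPlane hF).cont_deriv, gaussianTrial.integrable_norm_sq one_pos hF hs,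
      gaussianTrial.integrable_magneticDensity one_pos hF hs,
      gaussianTrial.integrable_boundary one_pos, ⟨0, le_rfl, by simp [gaussianTrial, h0]⟩, rfl⟩ ?_
    rintro r ⟨u, du, h1, h2, h3, hu, hm, hb, hne, rfl⟩
    have hc : IsC1HalfPlane u du := ⟨h1, h2, h3⟩
    rw [le_div_iff₀ (hc.integral_pos hu hne)]
    exact hc.Theta_mul_le γ hu hm hb
end
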